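/- arXiv:2507.12354 — 5 statements merged into one kernel-verified Lean document; each statement's English description precedes it below -/
import Mathlib

section
/- Let H be an 𝔽-free 3-graph on n vertices, and suppose S ⊆ V(H) is a set of five vertices that induces a copy of K₅³ in H. Let d_min := min_{v ∈ S} d_H(v). Then Σ_{v ∈ S} d_H(v) + (3/17)·d_min ≤ 61·n·(n+1)/34. Consequently, d_min ≤ 61·n·(n+1)/176. -/
/-- A 3-graph: every edge is a 3-element subset of the vertex set `Fin n`. -/
def Is3Graph {n : ℕ} (H : Finset (Finset (Fin n))) : Prop := ∀ e ∈ H, e.card = 3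

/-- The shadow of a 3-graph: the pairs contained in at least one edge. -/
def shadow3 {n : ℕ} (H : Finset (Finset (Fin n))) : Finset (Finset (Fin n)) :=
  Finset.univ.filter fun e => e.card = 2 ∧ ∃ E ∈ H, e ⊆ E

/-- The codegree of a pair `e`: the number of vertices `v` with `e ∪ {v} ∈ H`. -/
def codeg3 {n : ℕ} (H : Finset (Finset (Fin n))) (e : Finset (Fin n)) : ℕ :=
  (Finset.univ.filter fun v => v ∉ e ∧ insert v e ∈ H).card

/-- The ℓ2-norm of a 3-graph: `‖H‖₂ = ∑_{e ∈ ∂H} d_H(e)²`. -/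
def l2norm {n : ℕ} (H : Finset (Finset (Fin n))) : ℕ :=
  ∑ e ∈ shadow3 H, (codeg3 H e) ^ 2

/-- `H − v`: delete the vertex `v` and all edges containing it. -/
def delVert {n : ℕ} (H : Finset (Finset (Fin n))) (v : Fin n) : Finset (Finset (Fin n)) :=
  H.filter fun e => v ∉ e

/-- The ℓ2-norm degree of a vertex: `d_{2,H}(v) = ‖H‖₂ − ‖H − v‖₂`. -/
noncomputable def d2deg {n : ℕ} (H : Finset (Finset (Fin n))) (v : Fin n) : ℝ :=
  (l2norm H : ℝ) - (l2norm (delVert H v) : ℝ)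
/-- The edges of the Fano plane, as a 3-graph on `Fin 7` (0-indexed version of
the edge set {123, 345, 561, 174, 275, 376, 246}). -/
def fanoEdges : Finset (Finset (Fin 7)) :=
  {({0, 1, 2} : Finset (Fin 7)), {2, 3, 4}, {4, 5, 0}, {0, 6, 3}, {1, 6, 4}, {2, 6, 5}, {1, 3, 5}}

/-- A 3-graph is 𝔽-free if it contains no subgraph isomorphic to the Fano plane. -/
def FanoFree {n : ℕ} (H : Finset (Finset (Fin n))) : Prop :=
  ¬ ∃ f : Fin 7 → Fin n, Function.Injective f ∧ ∀ e ∈ fanoEdges, e.image f ∈ H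
/-- The degree of a vertex in a 3-graph: the number of edges containing it. -/
def vdeg3 {n : ℕ} (H : Finset (Finset (Fin n))) (v : Fin n) : ℕ :=
  (H.filter fun e => v ∈ e).card

/-- Condition on the weights of the three perfect matchings of a quadruple. -/
def QuadCond (m₁ m₂ m₃ : ℕ) : Prop :=
  m₁ ≤ 5 ∨ m₂ ≤ 5 ∨ m₃ ≤ 5 ∨ (m₁ ≤ 6 ∧ m₂ ≤ 6) ∨ (m₁ ≤ 6 ∧ m₃ ≤ 6) ∨ (m₂ ≤ 6 ∧ m₃ ≤ 6) ∨
    (m₁ ≤ 7 ∧ m₂ ≤ 7 ∧ m₃ ≤ 7)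

instance (m₁ m₂ m₃ : ℕ) : Decidable (QuadCond m₁ m₂ m₃) := by unfold QuadCond; infer_instance

/-- Pair weights `w` and vertex weights `g` on `V` with the local restrictions coming from
Fano-freeness. -/
structure IsFanoWeight {α : Type*} (V : Finset α) (w : α → α → ℕ) (g : α → ℕ) : Prop where
  symm : ∀ x y, w x y = w y x
  self : ∀ x, w x x = 0
  le_five : ∀ x y, w x y ≤ 5
  vertex_le : ∀ x, g x ≤ 20
  vertex_add_le : ∀ x ∈ V, ∀ y ∈ V, w x y = 5 → g x + g y ≤ 38
  quad : ∀ x ∈ V, ∀ y ∈ V, ∀ z ∈ V, ∀ t ∈ V, x ≠ y → x ≠ z → x ≠ t → y ≠ z → y ≠ t → z ≠ t →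
    QuadCond (w x y + w z t) (w x z + w y t) (w x t + w y z)

/-- A quadruple whose four cross pairs have weight `5` and whose remaining two pairs have
weight at least `2`. -/
structure IsTopQuad {α : Type*} (w : α → α → ℕ) (x₁ x₂ y₁ y₂ : α) : Prop where
  xx_ne : x₁ ≠ x₂
  yy_ne : y₁ ≠ y₂
  ne₁₁ : x₁ ≠ y₁
  ne₁₂ : x₁ ≠ y₂
  ne₂₁ : x₂ ≠ y₁
  ne₂₂ : x₂ ≠ y₂
  w₁₁ : w x₁ y₁ = 5
  w₁₂ : w x₁ y₂ = 5
  w₂₁ : w x₂ y₁ = 5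
  w₂₂ : w x₂ y₂ = 5
  two_le_xx : 2 ≤ w x₁ x₂
  two_le_yy : 2 ≤ w y₁ y₂

/-- `A` contains no top quadruple. -/
def NoTopQuad {α : Type*} (w : α → α → ℕ) (A : Finset α) : Prop :=
  ∀ x₁ ∈ A, ∀ x₂ ∈ A, ∀ y₁ ∈ A, ∀ y₂ ∈ A, ¬ IsTopQuad w x₁ x₂ y₁ y₂

/-- No triangle in `A` has a weight product in the list `L`. -/
def AvoidsProducts {α : Type*} (w : α → α → ℕ) (A : Finset α) (L : List ℕ) : Prop :=
  ∀ x ∈ A, ∀ y ∈ A, ∀ z ∈ A, x ≠ y → x ≠ z → y ≠ z → w x y * w x z * w y z ∉ L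

/-- The possible weights `a, b, c` from a fourth vertex to a triangle with weights `p, q, r`
when there are no top quadruples and the products in `L` are avoided. -/
def IsExtension (L : List ℕ) (p q r a b c : ℕ) : Prop :=
  QuadCond (a + r) (b + q) (c + p) ∧
  ¬ (b = 5 ∧ c = 5 ∧ p = 5 ∧ q = 5 ∧ 2 ≤ a ∧ 2 ≤ r) ∧
  ¬ (a = 5 ∧ c = 5 ∧ p = 5 ∧ r = 5 ∧ 2 ≤ b ∧ 2 ≤ q) ∧
  ¬ (a = 5 ∧ b = 5 ∧ q = 5 ∧ r = 5 ∧ 2 ≤ c ∧ 2 ≤ p) ∧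
  a * b * p ∉ L ∧ a * c * q ∉ L ∧ b * c * r ∉ L

instance (L : List ℕ) (p q r a b c : ℕ) : Decidable (IsExtension L p q r a b c) := by
  unfold IsExtension; infer_instance

section weights

variable {α : Type*} {V A : Finset α} {w : α → α → ℕ} {g : α → ℕ}

lemma IsFanoWeight.mono (h : IsFanoWeight V w g) (hA : A ⊆ V) : IsFanoWeight A w g where
  symm := h.symm
  self := h.self
  le_five := h.le_five
  vertex_le := h.vertex_le
  vertex_add_le x hx y hy := h.vertex_add_le x (hA hx) y (hA hy)
  quad x hx y hy z hz t ht := h.quad x (hA hx) y (hA hy) z (hA hz) t (hA ht)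

lemma IsFanoWeight.isExtension (h : IsFanoWeight A w g) (hT : NoTopQuad w A) {L : List ℕ}
    (hL : AvoidsProducts w A L) {v x y z : α} (hv : v ∈ A) (hx : x ∈ A) (hy : y ∈ A) (hz : z ∈ A)
    (hvx : v ≠ x) (hvy : v ≠ y) (hvz : v ≠ z) (hxy : x ≠ y) (hxz : x ≠ z) (hyz : y ≠ z) :
    IsExtension L (w x y) (w x z) (w y z) (w x v) (w y v) (w z v) := by
  have hs := h.symm
  refine ⟨?_, ?_, ?_, ?_, ?_, ?_, ?_⟩
  · have := h.quad v hv x hx y hy z hz hvx hvy hvz hxy hxz hyz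
    rwa [hs v x, hs v y, hs v z] at this
  · rintro ⟨h1, h2, h3, h4, h5, h6⟩
    exact hT x hx v hv y hy z hz ⟨hvx.symm, hyz, hxy, hxz, hvy, hvz, h3, h4,
      by rw [hs, h1], by rw [hs, h2], h5, h6⟩
  · rintro ⟨h1, h2, h3, h4, h5, h6⟩
    exact hT y hy v hv x hx z hz ⟨hvy.symm, hxz, hxy.symm, hyz, hvx, hvz, by rw [hs, h3], h4,
      by rw [hs, h1], by rw [hs, h2], h5, h6⟩
  · rintro ⟨h1, h2, h3, h4, h5, h6⟩
    exact hT z hz v hv x hx y hy ⟨hvz.symm, hxy, hxz.symm, hyz.symm, hvx, hvy,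
      by rw [hs, h3], by rw [hs, h4], by rw [hs, h1], by rw [hs, h2], h5, h6⟩
  · have := hL v hv x hx y hy hvx hvy hxy
    rwa [hs v x, hs v y] at this
  · have := hL v hv x hx z hz hvx hvz hxz
    rwa [hs v x, hs v z] at this
  · have := hL v hv y hy z hz hvy hvz hyz
    rwa [hs v y, hs v z] at this

lemma sum_split_triangle [DecidableEq α] {x y z : α} (hx : x ∈ A) (hy : y ∈ A) (hz : z ∈ A)
    (hxy : x ≠ y) (hxz : x ≠ z) (hyz : y ≠ z) (f : α → ℕ) {β : ℕ}
    (hf : ∀ v ∈ A, v ≠ x → v ≠ y → v ≠ z → f v ≤ β) :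
    ∃ t, A.card = t + 3 ∧ ∑ v ∈ A, f v ≤ f x + f y + f z + β * t := by
  have hy' : y ∈ A.erase x := Finset.mem_erase.2 ⟨hxy.symm, hy⟩
  have hz' : z ∈ (A.erase x).erase y :=
    Finset.mem_erase.2 ⟨hyz.symm, Finset.mem_erase.2 ⟨hxz.symm, hz⟩⟩
  refine ⟨(((A.erase x).erase y).erase z).card, ?_, ?_⟩
  · rw [← Finset.card_erase_add_one hx, ← Finset.card_erase_add_one hy',
      ← Finset.card_erase_add_one hz']
  · rw [← Finset.add_sum_erase _ _ hx, ← Finset.add_sum_erase _ _ hy',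
      ← Finset.add_sum_erase _ _ hz']
    have : ∑ v ∈ ((A.erase x).erase y).erase z, f v ≤
        (((A.erase x).erase y).erase z).card • β := by
      refine Finset.sum_le_card_nsmul _ _ _ fun v hv => ?_
      simp only [Finset.mem_erase] at hv
      exact hf v hv.2.2.2 hv.2.2.1 hv.2.1 hv.1
    rw [smul_eq_mul, mul_comm] at this
    omega

/-- If all degrees are large, a triangle type with a suitable weighting is impossible. -/
lemma IsFanoWeight.triangle_false [DecidableEq α] (h : IsFanoWeight A w g) (hT : NoTopQuad w A)
    (hdeg : ∀ x ∈ A, 37 * A.card + 209 < 11 * (∑ v ∈ A, w x v + g x)) {L : List ℕ}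
    (hL : AvoidsProducts w A L) (p q r l₁ l₂ l₃ β G : ℕ)
    (hext : ∀ a < 6, ∀ b < 6, ∀ c < 6, IsExtension L p q r a b c →
      l₁ * a + l₂ * b + l₃ * c ≤ β)
    (hG : ∀ a b c : ℕ, a ≤ 20 → b ≤ 20 → c ≤ 20 → (p = 5 → a + b ≤ 38) → (q = 5 → a + c ≤ 38) →
      (r = 5 → b + c ≤ 38) → l₁ * a + l₂ * b + l₃ * c ≤ G)
    (hnum : ∀ t : ℕ, 11 * (l₁ * (p + q) + l₂ * (p + r) + l₃ * (q + r) + β * t + G) ≤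
      (l₁ + l₂ + l₃) * (37 * (t + 3) + 209))
    (hpos : 0 < l₁ + l₂ + l₃)
    (x : α) (hx : x ∈ A) (y : α) (hy : y ∈ A) (z : α) (hz : z ∈ A)
    (hxy : x ≠ y) (hxz : x ≠ z) (hyz : y ≠ z)
    (hp : w x y = p) (hq : w x z = q) (hr : w y z = r) : False := by
  subst hp hq hr
  have hs := h.symm
  obtain ⟨t, ht, hsum⟩ := sum_split_triangle hx hy hz hxy hxz hyz
    (fun v => l₁ * w x v + l₂ * w y v + l₃ * w z v) (β := β) (fun v hv h1 h2 h3 =>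
      hext _ (Nat.lt_succ_of_le (h.le_five _ _)) _ (Nat.lt_succ_of_le (h.le_five _ _)) _
        (Nat.lt_succ_of_le (h.le_five _ _))
        (h.isExtension hT hL hv hx hy hz h1 h2 h3 hxy hxz hyz))
  have hGx := hG (g x) (g y) (g z) (h.vertex_le x) (h.vertex_le y) (h.vertex_le z)
    (h.vertex_add_le x hx y hy) (h.vertex_add_le x hx z hz) (h.vertex_add_le y hy z hz)
  simp only [Finset.sum_add_distrib, ← Finset.mul_sum, h.self, hs y x, hs z x, hs z y] at hsum
  have dx := hdeg x hx
  have dy := hdeg y hy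
  have dz := hdeg z hz
  have hn := hnum t
  rw [ht] at dx dy dz
  generalize ∑ v ∈ A, w x v = X at *
  generalize ∑ v ∈ A, w y v = Y at *
  generalize ∑ v ∈ A, w z v = Z at *
  have e₁ := Nat.mul_le_mul_left l₁ (Nat.succ_le_of_lt dx)
  have e₂ := Nat.mul_le_mul_left l₂ (Nat.succ_le_of_lt dy)
  have e₃ := Nat.mul_le_mul_left l₃ (Nat.succ_le_of_lt dz)
  simp only [Nat.succ_eq_add_one] at e₁ e₂ e₃
  linarith

lemma AvoidsProducts.cons {L : List ℕ} (hL : AvoidsProducts w A L) (hs : ∀ x y, w x y = w y x)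
    (h5 : ∀ x y, w x y ≤ 5) (p q r : ℕ)
    (hprod : ∀ a b c : Fin 6, (a * b * c : ℕ) = p * q * r →
      (a = p ∧ b = q ∧ c = r) ∨ (a = p ∧ b = r ∧ c = q) ∨ (a = q ∧ b = p ∧ c = r) ∨
      (a = q ∧ b = r ∧ c = p) ∨ (a = r ∧ b = p ∧ c = q) ∨ (a = r ∧ b = q ∧ c = p))
    (h : ∀ x ∈ A, ∀ y ∈ A, ∀ z ∈ A, x ≠ y → x ≠ z → y ≠ z →
      w x y = p → w x z = q → w y z = r → False) :
    AvoidsProducts w A (p * q * r :: L) := by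
  intro x hx y hy z hz hxy hxz hyz hmem
  rcases List.mem_cons.1 hmem with he | he
  · rcases hprod ⟨_, Nat.lt_succ_of_le (h5 x y)⟩ ⟨_, Nat.lt_succ_of_le (h5 x z)⟩
      ⟨_, Nat.lt_succ_of_le (h5 y z)⟩ he with ⟨a, b, c⟩ | ⟨a, b, c⟩ | ⟨a, b, c⟩ | ⟨a, b, c⟩ |
        ⟨a, b, c⟩ | ⟨a, b, c⟩
    · exact h x hx y hy z hz hxy hxz hyz a b c
    · exact h y hy x hx z hz hxy.symm hyz hxz (hs x y ▸ a) c b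
    · exact h x hx z hz y hy hxz hxy hyz.symm b a (hs y z ▸ c)
    · exact h y hy z hz x hx hyz hxy.symm hxz.symm c (hs x y ▸ a) (hs x z ▸ b)
    · exact h z hz x hx y hy hxz.symm hyz.symm hxy (hs x z ▸ b) (hs y z ▸ c) a
    · exact h z hz y hy x hx hyz.symm hxz.symm hxy.symm (hs y z ▸ c) (hs x z ▸ b) (hs x y ▸ a)
  · exact hL x hx y hy z hz hxy hxz hyz he

lemma IsFanoWeight.avoidsProducts [DecidableEq α] (h : IsFanoWeight A w g) (hT : NoTopQuad w A)
    (hdeg : ∀ x ∈ A, 37 * A.card + 209 < 11 * (∑ v ∈ A, w x v + g x)) :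
    AvoidsProducts w A [5 * 4 * 2, 3 * 3 * 5, 5 * 5 * 1, 5 * 5 * 2, 4 * 4 * 3, 5 * 4 * 3,
      5 * 5 * 3, 4 * 4 * 4, 5 * 4 * 4, 5 * 5 * 4, 5 * 5 * 5] := by
  have h0 : AvoidsProducts w A [] := fun _ _ _ _ _ _ _ _ _ => by simp
  have h1 := h0.cons h.symm h.le_five 5 5 5 (by decide)
    (h.triangle_false hT hdeg h0 5 5 5 1 1 1 10 57 (by decide) (by omega) (by omega) (by omega))
  have h2 := h1.cons h.symm h.le_five 5 5 4 (by decide)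
    (h.triangle_false hT hdeg h1 5 5 4 3 2 2 23 134 (by decide) (by omega) (by omega) (by omega))
  have h3 := h2.cons h.symm h.le_five 5 4 4 (by decide)
    (h.triangle_false hT hdeg h2 5 4 4 2 2 1 16 100 (by decide) (by omega) (by omega) (by omega))
  have h4 := h3.cons h.symm h.le_five 4 4 4 (by decide)
    (h.triangle_false hT hdeg h3 4 4 4 1 1 1 9 60 (by decide) (by omega) (by omega) (by omega))
  have h5 := h4.cons h.symm h.le_five 5 5 3 (by decide)
    (h.triangle_false hT hdeg h4 5 5 3 2 1 1 13 76 (by decide) (by omega) (by omega) (by omega))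
  have h6 := h5.cons h.symm h.le_five 5 4 3 (by decide)
    (h.triangle_false hT hdeg h5 5 4 3 3 2 1 20 120 (by decide) (by omega) (by omega) (by omega))
  have h7 := h6.cons h.symm h.le_five 4 4 3 (by decide)
    (h.triangle_false hT hdeg h6 4 4 3 1 1 1 10 60 (by decide) (by omega) (by omega) (by omega))
  have h8 := h7.cons h.symm h.le_five 5 5 2 (by decide)
    (h.triangle_false hT hdeg h7 5 5 2 5 3 3 37 220 (by decide) (by omega) (by omega) (by omega))
  have h9 := h8.cons h.symm h.le_five 5 5 1 (by decide)
    (h.triangle_false hT hdeg h8 5 5 1 1 0 1 6 40 (by decide) (by omega) (by omega) (by omega))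
  have h10 := h9.cons h.symm h.le_five 3 3 5 (by decide)
    (h.triangle_false hT hdeg h9 3 3 5 0 1 1 6 40 (by decide) (by omega) (by omega) (by omega))
  exact h10.cons h.symm h.le_five 5 4 2 (by decide)
    (h.triangle_false hT hdeg h10 5 4 2 1 1 0 6 40 (by decide) (by omega) (by omega) (by omega))

lemma IsFanoWeight.add_add_le_ten (h : IsFanoWeight A w g) {L : List ℕ}
    (hL : AvoidsProducts w A L)
    (hdec : ∀ a b c : Fin 6, (a * b * c : ℕ) ∉ L → (a + b + c : ℕ) ≤ 10)
    {x y z : α} (hx : x ∈ A) (hy : y ∈ A) (hz : z ∈ A)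
    (hxy : x ≠ y) (hxz : x ≠ z) (hyz : y ≠ z) : w x y + w x z + w y z ≤ 10 :=
  hdec ⟨_, Nat.lt_succ_of_le (h.le_five x y)⟩ ⟨_, Nat.lt_succ_of_le (h.le_five x z)⟩
    ⟨_, Nat.lt_succ_of_le (h.le_five y z)⟩ (hL x hx y hy z hz hxy hxz hyz)

lemma IsFanoWeight.exists_degree_le [DecidableEq α] (h : IsFanoWeight A w g)
    (hT : NoTopQuad w A) (hA : A.Nonempty) :
    ∃ x ∈ A, 11 * (∑ v ∈ A, w x v + g x) ≤ 37 * A.card + 209 := by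
  by_contra! hdeg
  have hL := h.avoidsProducts hT hdeg
  have h10 := fun x hx y hy z hz => h.add_add_le_ten hL (by decide) (x := x) (y := y) (z := z) hx hy hz
  by_cases hp : ∃ x ∈ A, ∃ y ∈ A, x ≠ y ∧ 4 ≤ w x y
  · obtain ⟨x, hx, y, hy, hxy, hp⟩ := hp
    have hy' : y ∈ A.erase x := Finset.mem_erase.2 ⟨hxy.symm, hy⟩
    have dx := hdeg x hx
    have dy := hdeg y hy
    have gx := h.vertex_le x
    have gy := h.vertex_le y
    have hp5 := h.le_five x y
    have hcard : A.card = ((A.erase x).erase y).card + 2 := by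
      rw [← Finset.card_erase_add_one hx, ← Finset.card_erase_add_one hy']
    have hsum : ∑ v ∈ (A.erase x).erase y, (w x v + w y v) ≤
        ((A.erase x).erase y).card • (10 - w x y) := by
      refine Finset.sum_le_card_nsmul _ _ _ fun v hv => ?_
      simp only [Finset.mem_erase] at hv
      have := h10 x hx y hy v hv.2.2 hxy hv.2.1.symm hv.1.symm
      omega
    rw [← Finset.add_sum_erase _ _ hx, ← Finset.add_sum_erase _ _ hy', h.self] at dx dy
    rw [h.symm y x] at dy
    rw [Finset.sum_add_distrib, smul_eq_mul] at hsum
    have h6 : ((A.erase x).erase y).card * (10 - w x y) ≤ ((A.erase x).erase y).card * 6 :=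
      Nat.mul_le_mul_left _ (by omega)
    omega
  · push Not at hp
    obtain ⟨x, hx⟩ := hA
    have dx := hdeg x hx
    have gx := h.vertex_le x
    have hcard := Finset.card_erase_add_one hx
    have hsum : ∑ v ∈ A.erase x, w x v ≤ (A.erase x).card • 3 := by
      refine Finset.sum_le_card_nsmul _ _ _ fun v hv => ?_
      have := hp x hx v (Finset.mem_of_mem_erase hv) (Finset.ne_of_mem_erase hv).symm
      omega
    rw [← Finset.add_sum_erase _ _ hx, h.self] at dx
    rw [smul_eq_mul] at hsum
    omega

lemma IsFanoWeight.sum_erase [DecidableEq α] (h : IsFanoWeight A w g) {x : α} (hx : x ∈ A) :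
    ∑ u ∈ A, ∑ v ∈ A, w u v =
      ∑ u ∈ A.erase x, ∑ v ∈ A.erase x, w u v + 2 * ∑ v ∈ A, w x v := by
  have h1 : ∀ u, ∑ v ∈ A, w u v = w u x + ∑ v ∈ A.erase x, w u v := fun u =>
    (Finset.add_sum_erase _ _ hx).symm
  rw [← Finset.add_sum_erase _ _ hx]
  simp only [h1, Finset.sum_add_distrib, h.self, h.symm _ x]
  ring

/-- The quadratic bound on the total weight in the absence of top quadruples. -/
lemma IsFanoWeight.total_le_of_noTopQuad [DecidableEq α] (h : IsFanoWeight A w g)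
    (hT : NoTopQuad w A) :
    11 * (∑ u ∈ A, ∑ v ∈ A, w u v + 2 * ∑ u ∈ A, g u) ≤ 37 * A.card ^ 2 + 455 * A.card := by
  induction hn : A.card generalizing A with
  | zero => simp [Finset.card_eq_zero.1 hn]
  | succ n ih =>
    obtain ⟨x, hx, hdeg⟩ := h.exists_degree_le hT (Finset.card_pos.1 (by omega))
    have hsub := Finset.erase_subset x A
    have := ih (h.mono hsub) (fun a ha b hb c hc d hd =>
      hT a (hsub ha) b (hsub hb) c (hsub hc) d (hsub hd)) (by rw [Finset.card_erase_of_mem hx]; omega)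
    rw [h.sum_erase hx, ← Finset.add_sum_erase _ g hx]
    rw [hn] at hdeg
    nlinarith

/-- The total weight sent by `v` to four vertices. -/
def quadSum (w : α → α → ℕ) (x₁ x₂ y₁ y₂ v : α) : ℕ := w x₁ v + w x₂ v + w y₁ v + w y₂ v

lemma IsFanoWeight.top_inner_le (h : IsFanoWeight V w g) {x₁ x₂ y₁ y₂ : α} (hx₁ : x₁ ∈ V)
    (hx₂ : x₂ ∈ V) (hy₁ : y₁ ∈ V) (hy₂ : y₂ ∈ V) (hQ : IsTopQuad w x₁ x₂ y₁ y₂) :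
    w x₁ x₂ + w y₁ y₂ ≤ 5 := by
  have := h.quad x₁ hx₁ x₂ hx₂ y₁ hy₁ y₂ hy₂ hQ.xx_ne hQ.ne₁₁ hQ.ne₁₂ hQ.ne₂₁ hQ.ne₂₂ hQ.yy_ne
  rw [hQ.w₁₁, hQ.w₂₂, hQ.w₁₂, hQ.w₂₁] at this
  unfold QuadCond at this
  omega

lemma IsFanoWeight.sender (h : IsFanoWeight V w g) {x₁ x₂ y₁ y₂ v : α} (hx₁ : x₁ ∈ V)
    (hx₂ : x₂ ∈ V) (hy₁ : y₁ ∈ V) (hy₂ : y₂ ∈ V) (hQ : IsTopQuad w x₁ x₂ y₁ y₂) (hv : v ∈ V)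
    (h₁ : v ≠ x₁) (h₂ : v ≠ x₂) (h₃ : v ≠ y₁) (h₄ : v ≠ y₂) :
    quadSum w x₁ x₂ y₁ y₂ v ≤ 14 ∧ (quadSum w x₁ x₂ y₁ y₂ v = 14 →
      (w x₁ v = 5 ∧ w x₂ v = 5 ∧ w y₁ v + w y₂ v = 4) ∨
      (w y₁ v = 5 ∧ w y₂ v = 5 ∧ w x₁ v + w x₂ v = 4)) := by
  have e := h.top_inner_le hx₁ hx₂ hy₁ hy₂ hQ
  have e₁ := h.quad v hv x₁ hx₁ x₂ hx₂ y₁ hy₁ h₁ h₂ h₃ hQ.xx_ne hQ.ne₁₁ hQ.ne₂₁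
  have e₂ := h.quad v hv x₁ hx₁ x₂ hx₂ y₂ hy₂ h₁ h₂ h₄ hQ.xx_ne hQ.ne₁₂ hQ.ne₂₂
  have e₃ := h.quad v hv y₁ hy₁ y₂ hy₂ x₁ hx₁ h₃ h₄ h₁ hQ.yy_ne hQ.ne₁₁.symm hQ.ne₁₂.symm
  have e₄ := h.quad v hv y₁ hy₁ y₂ hy₂ x₂ hx₂ h₃ h₄ h₂ hQ.yy_ne hQ.ne₂₁.symm hQ.ne₂₂.symm
  simp only [h.symm v, h.symm y₁ x₁, h.symm y₂ x₁, h.symm y₁ x₂, h.symm y₂ x₂, hQ.w₁₁, hQ.w₁₂,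
    hQ.w₂₁, hQ.w₂₂] at e₁ e₂ e₃ e₄
  have f₁ := h.le_five x₁ v
  have f₂ := h.le_five x₂ v
  have f₃ := h.le_five y₁ v
  have f₄ := h.le_five y₂ v
  have p := hQ.two_le_xx
  have q := hQ.two_le_yy
  unfold QuadCond at e₁ e₂ e₃ e₄
  unfold quadSum
  generalize w x₁ v = a at *
  generalize w x₂ v = b at *
  generalize w y₁ v = c at *
  generalize w y₂ v = d at *
  generalize w x₁ x₂ = p at *
  generalize w y₁ y₂ = q at *
  clear h hQ
  have key : a + b + c + d < 14 ∨ a + b + c + d = 14 ∧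
      ((a = 5 ∧ b = 5 ∧ c + d = 4) ∨ (c = 5 ∧ d = 5 ∧ a + b = 4)) := by
    interval_cases a <;> interval_cases b <;> omega
  omega

/-- The vertices outside a quadruple sending it total weight `14`. -/
def senders [DecidableEq α] (w : α → α → ℕ) (V : Finset α) (x₁ x₂ y₁ y₂ : α) : Finset α :=
  (V \ {x₁, x₂, y₁, y₂}).filter fun v => quadSum w x₁ x₂ y₁ y₂ v = 14

lemma IsTopQuad.card_eq_four [DecidableEq α] {x₁ x₂ y₁ y₂ : α} (hQ : IsTopQuad w x₁ x₂ y₁ y₂) :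
    ({x₁, x₂, y₁, y₂} : Finset α).card = 4 := by
  rw [Finset.card_insert_of_notMem, Finset.card_insert_of_notMem, Finset.card_insert_of_notMem,
    Finset.card_singleton] <;>
  simp [hQ.xx_ne, hQ.yy_ne, hQ.ne₁₁, hQ.ne₁₂, hQ.ne₂₁, hQ.ne₂₂]

lemma IsTopQuad.sum_eq [DecidableEq α] {x₁ x₂ y₁ y₂ : α} (hQ : IsTopQuad w x₁ x₂ y₁ y₂)
    (f : α → ℕ) : ∑ v ∈ ({x₁, x₂, y₁, y₂} : Finset α), f v = f x₁ + f x₂ + f y₁ + f y₂ := by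
  rw [Finset.sum_insert, Finset.sum_insert, Finset.sum_insert, Finset.sum_singleton] <;>
    simp [hQ.xx_ne, hQ.yy_ne, hQ.ne₁₁, hQ.ne₁₂, hQ.ne₂₁, hQ.ne₂₂, add_assoc]

lemma IsFanoWeight.top_degree_le [DecidableEq α] (h : IsFanoWeight V w g) {x₁ x₂ y₁ y₂ : α}
    (hx₁ : x₁ ∈ V) (hx₂ : x₂ ∈ V) (hy₁ : y₁ ∈ V) (hy₂ : y₂ ∈ V) (hQ : IsTopQuad w x₁ x₂ y₁ y₂) :
    ∑ u ∈ ({x₁, x₂, y₁, y₂} : Finset α), (∑ v ∈ V, w u v + 2 * g u) ≤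
      13 * V.card + (senders w V x₁ x₂ y₁ y₂).card + 150 := by
  have hsub : ({x₁, x₂, y₁, y₂} : Finset α) ⊆ V := by
    simp [Finset.insert_subset_iff, *]
  have hs : ∀ v ∈ V \ {x₁, x₂, y₁, y₂}, quadSum w x₁ x₂ y₁ y₂ v ≤
      13 + if quadSum w x₁ x₂ y₁ y₂ v = 14 then 1 else 0 := by
    intro v hv
    simp only [Finset.mem_sdiff, Finset.mem_insert, Finset.mem_singleton, not_or] at hv
    have := (h.sender hx₁ hx₂ hy₁ hy₂ hQ hv.1 hv.2.1 hv.2.2.1 hv.2.2.2.1 hv.2.2.2.2).1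
    split_ifs <;> omega
  have hsum := Finset.sum_le_sum hs
  rw [Finset.sum_add_distrib, Finset.sum_const, ← Finset.card_filter] at hsum
  have hcard := Finset.card_sdiff_add_card_eq_card hsub
  rw [hQ.card_eq_four] at hcard
  have htot := Finset.sum_sdiff (f := quadSum w x₁ x₂ y₁ y₂) hsub
  rw [hQ.sum_eq (quadSum w x₁ x₂ y₁ y₂)] at htot
  have hin := h.top_inner_le hx₁ hx₂ hy₁ hy₂ hQ
  have g₁ := h.vertex_add_le x₁ hx₁ y₁ hy₁ hQ.w₁₁
  have g₂ := h.vertex_add_le x₂ hx₂ y₂ hy₂ hQ.w₂₂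
  rw [hQ.sum_eq]
  have hV : ∑ v ∈ V, quadSum w x₁ x₂ y₁ y₂ v =
      ∑ v ∈ V, w x₁ v + ∑ v ∈ V, w x₂ v + ∑ v ∈ V, w y₁ v + ∑ v ∈ V, w y₂ v := by
    simp only [quadSum, Finset.sum_add_distrib]
  have hinner : quadSum w x₁ x₂ y₁ y₂ x₁ + quadSum w x₁ x₂ y₁ y₂ x₂ + quadSum w x₁ x₂ y₁ y₂ y₁ +
      quadSum w x₁ x₂ y₁ y₂ y₂ = 40 + 2 * (w x₁ x₂ + w y₁ y₂) := by
    simp only [quadSum, h.self, h.symm x₂ x₁, h.symm y₁ x₁, h.symm y₂ x₁, h.symm y₁ x₂,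
      h.symm y₂ x₂, h.symm y₂ y₁, hQ.w₁₁, hQ.w₁₂, hQ.w₂₁, hQ.w₂₂]
    ring
  simp only [smul_eq_mul] at hsum
  unfold senders
  omega

/-- Greedily removing disjoint top quadruples. -/
lemma IsFanoWeight.exists_peeling [DecidableEq α] (h : IsFanoWeight V w g) (F : α → ℕ) (C : ℕ)
    (hC : ∀ x₁ ∈ V, ∀ x₂ ∈ V, ∀ y₁ ∈ V, ∀ y₂ ∈ V, IsTopQuad w x₁ x₂ y₁ y₂ →
      ∑ u ∈ ({x₁, x₂, y₁, y₂} : Finset α), F u ≤ C) (A : Finset α) (hA : A ⊆ V) :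
    ∃ k, ∃ R ⊆ A, A.card = 4 * k + R.card ∧ NoTopQuad w R ∧
      ∑ u ∈ A, F u ≤ k * C + ∑ u ∈ R, F u ∧
      ∑ u ∈ R, ∑ v ∈ A, w u v ≤ 14 * k * R.card + ∑ u ∈ R, ∑ v ∈ R, w u v := by
  induction hn : A.card using Nat.strong_induction_on generalizing A with
  | _ n ih =>
  by_cases hT : NoTopQuad w A
  · exact ⟨0, A, subset_rfl, by simp [hn], hT, by simp, by simp⟩
  · simp only [NoTopQuad, not_forall, not_not] at hT
    obtain ⟨x₁, hx₁, x₂, hx₂, y₁, hy₁, y₂, hy₂, hQ⟩ := hT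
    have hsub : ({x₁, x₂, y₁, y₂} : Finset α) ⊆ A := by
      simp [Finset.insert_subset_iff, *]
    have hcard := Finset.card_sdiff_add_card_eq_card hsub
    rw [hQ.card_eq_four] at hcard
    obtain ⟨k, R, hR, hRc, hRT, hF, hw⟩ := ih _ (by omega) (A \ {x₁, x₂, y₁, y₂})
      (Finset.sdiff_subset.trans hA) rfl
    refine ⟨k + 1, R, hR.trans Finset.sdiff_subset, by omega, hRT, ?_, ?_⟩
    · rw [← Finset.sum_sdiff hsub]
      have := hC x₁ (hA hx₁) x₂ (hA hx₂) y₁ (hA hy₁) y₂ (hA hy₂) hQ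
      linarith
    · have hs : ∀ u ∈ R, ∑ v ∈ A, w u v ≤ ∑ v ∈ A \ {x₁, x₂, y₁, y₂}, w u v + 14 := by
        intro u hu
        have hu' := hR hu
        simp only [Finset.mem_sdiff, Finset.mem_insert, Finset.mem_singleton, not_or] at hu'
        have := (h.sender (hA hx₁) (hA hx₂) (hA hy₁) (hA hy₂) hQ (hA hu'.1) hu'.2.1 hu'.2.2.1
          hu'.2.2.2.1 hu'.2.2.2.2).1
        rw [← Finset.sum_sdiff hsub, hQ.sum_eq, h.symm u x₁, h.symm u x₂, h.symm u y₁,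
          h.symm u y₂]
        unfold quadSum at this
        omega
      have := Finset.sum_le_sum hs
      rw [Finset.sum_add_distrib, Finset.sum_const, smul_eq_mul] at this
      linarith

lemma IsTopQuad.swap {x₁ x₂ y₁ y₂ : α} (hs : ∀ x y, w x y = w y x)
    (hQ : IsTopQuad w x₁ x₂ y₁ y₂) : IsTopQuad w y₁ y₂ x₁ x₂ :=
  ⟨hQ.yy_ne, hQ.xx_ne, hQ.ne₁₁.symm, hQ.ne₂₁.symm, hQ.ne₁₂.symm, hQ.ne₂₂.symm,
    by rw [hs, hQ.w₁₁], by rw [hs, hQ.w₂₁], by rw [hs, hQ.w₁₂], by rw [hs, hQ.w₂₂],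
    hQ.two_le_yy, hQ.two_le_xx⟩

end weights

section colours

variable {α γ : Type*} [DecidableEq γ]

/-- The three sets have no system of distinct representatives. -/
def NoSDR (A B C : Finset γ) : Prop :=
  ¬ ∃ a ∈ A, ∃ b ∈ B, ∃ c ∈ C, a ≠ b ∧ a ≠ c ∧ b ≠ c

lemma NoSDR.hall {A B C : Finset γ} (h : NoSDR A B C) :
    A = ∅ ∨ B = ∅ ∨ C = ∅ ∨ (A ∪ B).card ≤ 1 ∨ (A ∪ C).card ≤ 1 ∨ (B ∪ C).card ≤ 1 ∨
      (A ∪ B ∪ C).card ≤ 2 := by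
  by_contra! hne
  obtain ⟨hA, hB, hC, hAB, hAC, hBC, hABC⟩ := hne
  have key : ∀ s : Finset (Fin 3), s.card ≤ (s.biUnion ![A, B, C]).card := by
    have hA := Finset.card_pos.2 hA
    have hB := Finset.card_pos.2 hB
    have hC := Finset.card_pos.2 hC
    intro s
    have hs : s ∈ (Finset.univ : Finset (Fin 3)).powerset := by simp
    have : (Finset.univ : Finset (Fin 3)).powerset =
      {∅, {0}, {1}, {2}, {0, 1}, {0, 2}, {1, 2}, {0, 1, 2}} := by decide
    rw [this] at hs
    simp only [Finset.mem_insert, Finset.mem_singleton] at hs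
    rcases hs with rfl | rfl | rfl | rfl | rfl | rfl | rfl | rfl
    · simp
    · simpa using hA
    · simpa using hB
    · simpa using hC
    · simpa [Finset.biUnion_insert] using Nat.succ_le_of_lt hAB
    · simpa [Finset.biUnion_insert] using Nat.succ_le_of_lt hAC
    · simpa [Finset.biUnion_insert] using Nat.succ_le_of_lt hBC
    · simpa [Finset.biUnion_insert, ← Finset.union_assoc] using Nat.succ_le_of_lt hABC
  obtain ⟨f, hf, hm⟩ := (Finset.all_card_le_biUnion_card_iff_exists_injective ![A, B, C]).1 key
  exact h ⟨f 0, hm 0, f 1, hm 1, f 2, hm 2, hf.ne (by decide), hf.ne (by decide),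
    hf.ne (by decide)⟩

/-- Assignments of subsets of a `5`-set `S` to the pairs in `V` with the local restriction coming
from Fano-freeness. -/
structure IsFanoColouring (S : Finset γ) (V : Finset α) (X : α → α → Finset γ) : Prop where
  card : S.card = 5
  subset : ∀ x y, X x y ⊆ S
  symm : ∀ x y, X x y = X y x
  self : ∀ x, X x x = ∅
  quad : ∀ x ∈ V, ∀ y ∈ V, ∀ z ∈ V, ∀ t ∈ V, x ≠ y → x ≠ z → x ≠ t → y ≠ z → y ≠ t → z ≠ t →
    NoSDR (X x y ∩ X z t) (X x z ∩ X y t) (X x t ∩ X y z)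

variable {S : Finset γ} {V : Finset α} {X : α → α → Finset γ}

lemma IsFanoColouring.add_le (h : IsFanoColouring S V X) (x y z t : α) :
    (X x y).card + (X z t).card ≤ 5 + (X x y ∩ X z t).card := by
  rw [← Finset.card_union_add_card_inter, ← h.card]
  exact Nat.add_le_add_right (Finset.card_le_card (Finset.union_subset (h.subset _ _)
    (h.subset _ _))) _

lemma IsFanoColouring.quadCond (h : IsFanoColouring S V X) {x y z t : α} (hx : x ∈ V) (hy : y ∈ V)
    (hz : z ∈ V) (ht : t ∈ V) (hxy : x ≠ y) (hxz : x ≠ z) (hxt : x ≠ t) (hyz : y ≠ z)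
    (hyt : y ≠ t) (hzt : z ≠ t) :
    QuadCond ((X x y).card + (X z t).card) ((X x z).card + (X y t).card)
      ((X x t).card + (X y z).card) := by
  have h₁ := h.add_le x y z t
  have h₂ := h.add_le x z y t
  have h₃ := h.add_le x t y z
  have hq := (h.quad x hx y hy z hz t ht hxy hxz hxt hyz hyt hzt).hall
  generalize X x y ∩ X z t = A at *
  generalize X x z ∩ X y t = B at *
  generalize X x t ∩ X y z = C at *
  have a₁ := Finset.card_le_card (Finset.subset_union_left (s₁ := A) (s₂ := B))
  have a₂ := Finset.card_le_card (Finset.subset_union_right (s₁ := A) (s₂ := B))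
  have a₃ := Finset.card_le_card (Finset.subset_union_left (s₁ := A) (s₂ := C))
  have a₄ := Finset.card_le_card (Finset.subset_union_right (s₁ := A) (s₂ := C))
  have a₅ := Finset.card_le_card (Finset.subset_union_left (s₁ := B) (s₂ := C))
  have a₆ := Finset.card_le_card (Finset.subset_union_right (s₁ := B) (s₂ := C))
  have a₇ := Finset.card_le_card (Finset.subset_union_left (s₁ := A ∪ B) (s₂ := C))
  have a₈ := Finset.card_le_card (Finset.subset_union_right (s₁ := A ∪ B) (s₂ := C))
  unfold QuadCond
  rcases hq with rfl | rfl | rfl | hq | hq | hq | hq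
  · simp only [Finset.card_empty] at *
    omega
  · simp only [Finset.card_empty] at *
    omega
  · simp only [Finset.card_empty] at *
    omega
  all_goals omega

lemma IsFanoColouring.eq_of_card (h : IsFanoColouring S V X) {x y : α}
    (hc : (X x y).card = 5) : X x y = S :=
  Finset.eq_of_subset_of_card_le (h.subset x y) (by rw [h.card, hc])

/-- A vertex joined completely to `x₁, x₂` and sending total weight `4` to `y₁, y₂`. -/
def IsCompleteTo (X : α → α → Finset γ) (x₁ x₂ y₁ y₂ v : α) : Prop :=
  (X x₁ v).card = 5 ∧ (X x₂ v).card = 5 ∧ (X y₁ v).card + (X y₂ v).card = 4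

lemma IsFanoColouring.sender_eq (h : IsFanoColouring S V X) {x₁ x₂ y₁ y₂ v : α} (hx₁ : x₁ ∈ V)
    (hx₂ : x₂ ∈ V) (hy₁ : y₁ ∈ V) (hy₂ : y₂ ∈ V)
    (hQ : IsTopQuad (fun x y => (X x y).card) x₁ x₂ y₁ y₂) (hv : v ∈ V)
    (h₁ : v ≠ x₁) (h₂ : v ≠ x₂) (h₃ : v ≠ y₁) (h₄ : v ≠ y₂)
    (hc : IsCompleteTo X x₁ x₂ y₁ y₂ v) :
    (X y₁ y₂).card = 2 ∧ X y₁ v = X y₁ y₂ ∧ X y₂ v = X y₁ y₂ := by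
  obtain ⟨c₁, c₂, c₃⟩ := hc
  have e₁ := h.quadCond hv hx₁ hx₂ hy₁ h₁ h₂ h₃ hQ.xx_ne hQ.ne₁₁ hQ.ne₂₁
  have e₂ := h.quadCond hv hx₁ hx₂ hy₂ h₁ h₂ h₄ hQ.xx_ne hQ.ne₁₂ hQ.ne₂₂
  have w₁₁ := hQ.w₁₁
  have w₁₂ := hQ.w₁₂
  have w₂₁ := hQ.w₂₁
  have w₂₂ := hQ.w₂₂
  have p := hQ.two_le_xx
  have q := hQ.two_le_yy
  simp only [h.symm v] at *
  have e₃ := (h.quad v hv y₁ hy₁ y₂ hy₂ x₁ hx₁ h₃ h₄ h₁ hQ.yy_ne hQ.ne₁₁.symm hQ.ne₁₂.symm).hall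
  rw [h.symm v, h.symm v, h.symm v, h.symm y₂ x₁, h.symm y₁ x₁, h.eq_of_card w₁₁,
    h.eq_of_card w₁₂, h.eq_of_card c₁, Finset.inter_eq_left.2 (h.subset _ _),
    Finset.inter_eq_left.2 (h.subset _ _), Finset.inter_eq_right.2 (h.subset _ _)] at e₃
  have b₁ : 1 ≤ (X y₁ v).card ∧ 1 ≤ (X y₂ v).card := by
    unfold QuadCond at e₁ e₂
    rw [c₁, c₂, w₁₁, w₂₁] at e₁
    rw [c₁, c₂, w₁₂, w₂₂] at e₂
    omega
  generalize X y₁ v = A at *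
  generalize X y₂ v = B at *
  generalize X y₁ y₂ = C at *
  have a₁ := Finset.card_le_card (Finset.subset_union_left (s₁ := A) (s₂ := B))
  have a₂ := Finset.card_le_card (Finset.subset_union_right (s₁ := A) (s₂ := B))
  have a₄ := Finset.card_le_card (Finset.subset_union_right (s₁ := A) (s₂ := C))
  have a₆ := Finset.card_le_card (Finset.subset_union_right (s₁ := B) (s₂ := C))
  have a₇ := Finset.card_le_card (Finset.subset_union_left (s₁ := A ∪ B) (s₂ := C))
  have a₈ := Finset.card_le_card (Finset.subset_union_right (s₁ := A ∪ B) (s₂ := C))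
  rcases e₃ with rfl | rfl | rfl | e | e | e | e
  · simp at b₁
  · simp at b₁
  · simp at q
  · omega
  · omega
  · omega
  · have hC : C = A ∪ B ∪ C :=
      Finset.eq_of_subset_of_card_le Finset.subset_union_right (by omega)
    have hAC : A ⊆ C := by
      rw [hC]; exact Finset.subset_union_left.trans Finset.subset_union_left
    have hBC : B ⊆ C := by
      rw [hC]; exact Finset.subset_union_right.trans Finset.subset_union_left
    have hA := Finset.card_le_card hAC
    have hB := Finset.card_le_card hBC
    exact ⟨by omega, Finset.eq_of_subset_of_card_le hAC (by omega),
      Finset.eq_of_subset_of_card_le hBC (by omega)⟩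

lemma IsFanoColouring.exists_small (h : IsFanoColouring S V X) {x₁ x₂ y₁ y₂ : α} (hx₁ : x₁ ∈ V)
    (hx₂ : x₂ ∈ V) (hy₁ : y₁ ∈ V) (hy₂ : y₂ ∈ V)
    (hQ : IsTopQuad (fun x y => (X x y).card) x₁ x₂ y₁ y₂) (P : Finset α)
    (hP : ∀ v ∈ P, v ∈ V ∧ v ≠ x₁ ∧ v ≠ x₂ ∧ v ≠ y₁ ∧ v ≠ y₂ ∧ IsCompleteTo X x₁ x₂ y₁ y₂ v) :
    ∃ Y : Finset γ, Y.card ≤ 2 ∧ ∀ u ∈ P, ∀ v ∈ P, u ≠ v → X u v ⊆ Y := by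
  have hP' := fun v hv => by
    obtain ⟨h0, h1, h2, h3, h4, h5⟩ := hP v hv
    exact h.sender_eq hx₁ hx₂ hy₁ hy₂ hQ h0 h1 h2 h3 h4 h5
  rcases P.eq_empty_or_nonempty with rfl | ⟨v₀, hv₀⟩
  · exact ⟨∅, by simp, by simp⟩
  · refine ⟨X y₁ y₂, (hP' v₀ hv₀).1.le, fun u hu v hv huv => ?_⟩
    obtain ⟨uV, u1, u2, u3, u4, cu⟩ := hP u hu
    obtain ⟨vV, v1, v2, v3, v4, cv⟩ := hP v hv
    obtain ⟨hY, eu, -⟩ := hP' u hu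
    obtain ⟨-, ev, -⟩ := hP' v hv
    have hq := (h.quad u uV v vV x₁ hx₁ y₁ hy₁ huv u1 u3 v1 v3 hQ.ne₁₁).hall
    rw [h.eq_of_card hQ.w₁₁, h.symm u x₁, h.symm u y₁, h.symm v x₁, h.symm v y₁, eu, ev,
      h.eq_of_card cu.1, h.eq_of_card cv.1, Finset.inter_eq_left.2 (h.subset _ _),
      Finset.inter_eq_left.2 (h.subset _ _), Finset.inter_eq_right.2 (h.subset _ _)] at hq
    generalize X u v = A at *
    generalize X y₁ y₂ = Y at *
    have a₁ := Finset.card_le_card (Finset.subset_union_right (s₁ := A) (s₂ := Y))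
    rcases hq with rfl | rfl | rfl | e | e | e | e
    · simp
    · simp at hY
    · simp at hY
    · omega
    · omega
    · rw [Finset.union_self] at e
      omega
    · rw [Finset.union_assoc, Finset.union_self] at e
      have : Y = A ∪ Y := Finset.eq_of_subset_of_card_le Finset.subset_union_right (by omega)
      rw [this]
      exact Finset.subset_union_left

/-- Around every top quadruple some colour class is bipartite on the set of senders. -/
lemma IsFanoColouring.exists_colour [DecidableEq α] (h : IsFanoColouring S V X) {g : α → ℕ}
    (hw : IsFanoWeight V (fun x y => (X x y).card) g) {x₁ x₂ y₁ y₂ : α} (hx₁ : x₁ ∈ V)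
    (hx₂ : x₂ ∈ V) (hy₁ : y₁ ∈ V) (hy₂ : y₂ ∈ V)
    (hQ : IsTopQuad (fun x y => (X x y).card) x₁ x₂ y₁ y₂) :
    ∃ c ∈ S, ∃ P ⊆ senders (fun x y => (X x y).card) V x₁ x₂ y₁ y₂,
      (∀ u ∈ P, ∀ v ∈ P, u ≠ v → c ∉ X u v) ∧
      ∀ u ∈ senders (fun x y => (X x y).card) V x₁ x₂ y₁ y₂ \ P,
        ∀ v ∈ senders (fun x y => (X x y).card) V x₁ x₂ y₁ y₂ \ P, u ≠ v → c ∉ X u v := by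
  classical
  set M := senders (fun x y => (X x y).card) V x₁ x₂ y₁ y₂ with hM
  have hMv : ∀ v ∈ M, v ∈ V ∧ v ≠ x₁ ∧ v ≠ x₂ ∧ v ≠ y₁ ∧ v ≠ y₂ ∧
      (IsCompleteTo X x₁ x₂ y₁ y₂ v ∨ IsCompleteTo X y₁ y₂ x₁ x₂ v) := by
    intro v hv
    simp only [hM, senders, Finset.mem_filter, Finset.mem_sdiff, Finset.mem_insert,
      Finset.mem_singleton, not_or] at hv
    obtain ⟨⟨hv, h1, h2, h3, h4⟩, h5⟩ := hv
    exact ⟨hv, h1, h2, h3, h4, (hw.sender hx₁ hx₂ hy₁ hy₂ hQ hv h1 h2 h3 h4).2 h5⟩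
  obtain ⟨Y, hY, hYP⟩ := h.exists_small hx₁ hx₂ hy₁ hy₂ hQ
    (M.filter fun v => IsCompleteTo X x₁ x₂ y₁ y₂ v) (by
      intro v hv
      rw [Finset.mem_filter] at hv
      obtain ⟨a, b, c, d, e, -⟩ := hMv v hv.1
      exact ⟨a, b, c, d, e, hv.2⟩)
  obtain ⟨Z, hZ, hZP⟩ := h.exists_small hy₁ hy₂ hx₁ hx₂ (hQ.swap hw.symm)
    (M \ M.filter fun v => IsCompleteTo X x₁ x₂ y₁ y₂ v) (by
      intro v hv
      rw [Finset.mem_sdiff, Finset.mem_filter] at hv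
      obtain ⟨a, b, c, d, e, f⟩ := hMv v hv.1
      exact ⟨a, d, e, b, c, f.resolve_left fun hf => hv.2 ⟨hv.1, hf⟩⟩)
  obtain ⟨c, hcS, hc⟩ : ∃ c ∈ S, c ∉ Y ∪ Z := by
    by_contra! hcon
    have h1 := Finset.card_le_card (show S ⊆ Y ∪ Z from hcon)
    have h2 := Finset.card_union_le Y Z
    have h3 := h.card
    omega
  rw [Finset.mem_union, not_or] at hc
  exact ⟨c, hcS, _, Finset.filter_subset _ _, fun u hu v hv huv hm => hc.1 (hYP u hu v hv huv hm),
    fun u hu v hv huv hm => hc.2 (hZP u hu v hv huv hm)⟩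

/-- The number of ordered pairs of colour `c` when `c` is bipartite on the set `M`. -/
lemma IsFanoColouring.colour_count_le [DecidableEq α] (h : IsFanoColouring S V X) {c : γ}
    {M P : Finset α} (hM : M ⊆ V) (hPM : P ⊆ M) (hP : ∀ u ∈ P, ∀ v ∈ P, u ≠ v → c ∉ X u v)
    (hP' : ∀ u ∈ M \ P, ∀ v ∈ M \ P, u ≠ v → c ∉ X u v) :
    2 * ∑ u ∈ V, ∑ v ∈ V, (if c ∈ X u v then 1 else 0) + M.card ^ 2 + 2 * V.card ≤
      2 * V.card ^ 2 + 2 * M.card := by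
  have hsub : (V ×ˢ V).filter (fun p => c ∈ X p.1 p.2) ⊆
      V.offDiag \ (P.offDiag ∪ (M \ P).offDiag) := by
    rintro ⟨u, v⟩ huv
    simp only [Finset.mem_filter, Finset.mem_product] at huv
    have hne : u ≠ v := by
      rintro rfl
      simp [h.self] at huv
    simp only [Finset.mem_sdiff, Finset.mem_union, Finset.mem_offDiag, not_or]
    exact ⟨⟨huv.1.1, huv.1.2, hne⟩, fun hu => hP u hu.1 v hu.2.1 hne huv.2,
      fun hu => hP' u (Finset.mem_sdiff.2 hu.1) v (Finset.mem_sdiff.2 hu.2.1) hne huv.2⟩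
  have hcard := Finset.card_le_card hsub
  have hdisj : Disjoint P.offDiag (M \ P).offDiag := by
    rw [Finset.disjoint_left]
    rintro ⟨u, v⟩ h1 h2
    exact (Finset.mem_sdiff.1 (Finset.mem_offDiag.1 h2).1).2 (Finset.mem_offDiag.1 h1).1
  have hin : P.offDiag ∪ (M \ P).offDiag ⊆ V.offDiag :=
    Finset.union_subset (Finset.offDiag_mono (hPM.trans hM))
      (Finset.offDiag_mono (Finset.sdiff_subset.trans hM))
  have h1 := Finset.card_sdiff_add_card_eq_card hin
  rw [Finset.card_union_of_disjoint hdisj, Finset.offDiag_card, Finset.offDiag_card,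
    Finset.offDiag_card] at h1
  have h2 := Finset.card_sdiff_add_card_eq_card hPM
  rw [Finset.card_filter, Finset.sum_product] at hcard
  generalize ∑ u ∈ V, ∑ v ∈ V, (if c ∈ X u v then 1 else 0) = T at *
  have a₁ := Nat.le_mul_self P.card
  have a₂ := Nat.le_mul_self (M \ P).card
  have a₃ := Nat.le_mul_self V.card
  rw [← h2]
  generalize P.card = p at *
  generalize (M \ P).card = q at *
  generalize V.card = m at *
  zify [a₁, a₂, a₃] at *
  nlinarith [sq_nonneg ((p : ℤ) - q)]

end colours

section hypergraph

variable {n : ℕ} {H : Finset (Finset (Fin n))} {S : Finset (Fin n)}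

lemma FanoFree.false_of_edges (hF : FanoFree H) {a b c d e f g : Fin n}
    (hn : [a, b, c, d, e, f, g].Nodup) (h₁ : {a, b, c} ∈ H) (h₂ : {c, d, e} ∈ H)
    (h₃ : {e, f, a} ∈ H) (h₄ : {a, g, d} ∈ H) (h₅ : {b, g, e} ∈ H) (h₆ : {c, g, f} ∈ H)
    (h₇ : {b, d, f} ∈ H) : False := by
  refine hF ⟨[a, b, c, d, e, f, g].get, List.nodup_iff_injective_get.1 hn, ?_⟩
  intro E hE
  simp only [fanoEdges, Finset.mem_insert, Finset.mem_singleton] at hE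
  rcases hE with rfl | rfl | rfl | rfl | rfl | rfl | rfl <;>
    simpa [Finset.image_insert, Finset.image_singleton]

/-- The colours in `S` forming an edge with the pair `u, v`. -/
def pairColours (H : Finset (Finset (Fin n))) (S : Finset (Fin n)) (u v : Fin n) :
    Finset (Fin n) :=
  S.filter fun s => {s, u, v} ∈ H

/-- The number of ordered pairs from `S` forming an edge with `x`. -/
def linkCount (H : Finset (Finset (Fin n))) (S : Finset (Fin n)) (x : Fin n) : ℕ :=
  ((S ×ˢ S).filter fun p => {p.1, p.2, x} ∈ H).card

lemma Is3Graph.ne_of_mem (hH : Is3Graph H) {a b c : Fin n} (h : {a, b, c} ∈ H) :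
    a ≠ b ∧ a ≠ c ∧ b ≠ c := by
  refine ⟨?_, ?_, ?_⟩
  all_goals
    rintro rfl
    have h3 := hH _ h
    clear h
  · have h2 := Finset.card_le_two (a := a) (b := c)
    rw [Finset.insert_idem] at h3
    omega
  · have h2 := Finset.card_le_two (a := a) (b := b)
    rw [Finset.pair_comm, Finset.insert_idem] at h3
    omega
  · have h2 := Finset.card_le_two (a := a) (b := b)
    rw [Finset.pair_eq_singleton] at h3
    omega

lemma pairColours_isFanoColouring (hH : Is3Graph H) (hF : FanoFree H) (hS : S.card = 5)
    (hind : ∀ t ⊆ S, t.card = 3 → t ∈ H) : IsFanoColouring S Sᶜ (pairColours H S) where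
  card := hS
  subset _ _ := Finset.filter_subset _ _
  symm x y := by simp only [pairColours, Finset.pair_comm x y]
  self x := by
    refine Finset.filter_eq_empty_iff.2 fun s _ h => ?_
    exact (hH.ne_of_mem h).2.2 rfl
  quad x hx y hy z hz t ht hxy hxz hxt hyz hyt hzt := by
    rintro ⟨c, hc, b, hb, a, ha, hcb, hca, hba⟩
    simp only [pairColours, Finset.mem_inter, Finset.mem_filter] at ha hb hc
    rw [Finset.mem_compl] at hx hy hz ht
    have hne : ∀ {s v : Fin n}, s ∈ S → v ∉ S → s ≠ v := fun hs hv h => hv (h ▸ hs)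
    refine hF.false_of_edges (a := a) (b := b) (c := c) (d := x) (e := y) (f := z) (g := t)
      ?_ (hind _ ?_ ?_) hc.1.2 ?_ ?_ ?_ ?_ hb.1.2
    · simp [hcb.symm, hca.symm, hba.symm, hxy, hxz, hxt, hyz, hyt, hzt, hne ha.1.1 hx,
        hne ha.1.1 hy, hne ha.1.1 hz, hne ha.1.1 ht, hne hb.1.1 hx, hne hb.1.1 hy, hne hb.1.1 hz,
        hne hb.1.1 ht, hne hc.1.1 hx, hne hc.1.1 hy, hne hc.1.1 hz, hne hc.1.1 ht]
    · simp [Finset.insert_subset_iff, ha.1.1, hb.1.1, hc.1.1]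
    · exact Finset.card_eq_three.2 ⟨a, b, c, hba.symm, hca.symm, hcb.symm, rfl⟩
    · have := ha.2.2
      rwa [Finset.insert_comm, Finset.pair_comm a z] at this
    · have := ha.1.2
      rwa [Finset.pair_comm x t] at this
    · have := hb.2.2
      rwa [Finset.pair_comm y t] at this
    · have := hc.2.2
      rwa [Finset.pair_comm z t] at this

lemma linkCount_filter_subset (hH : Is3Graph H) (x : Fin n) :
    (S ×ˢ S).filter (fun p => {p.1, p.2, x} ∈ H) ⊆ S.offDiag := by
  rintro ⟨s, t⟩ h
  simp only [Finset.mem_filter, Finset.mem_product] at h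
  exact Finset.mem_offDiag.2 ⟨h.1.1, h.1.2, (hH.ne_of_mem h.2).1⟩

lemma linkCount_le (hH : Is3Graph H) (hS : S.card = 5) (x : Fin n) : linkCount H S x ≤ 20 := by
  have := Finset.card_le_card (linkCount_filter_subset (S := S) hH x)
  rwa [Finset.offDiag_card, hS] at this

lemma forall_mem_of_linkCount (hH : Is3Graph H) (hS : S.card = 5) {x : Fin n}
    (hx : 18 < linkCount H S x) {s t : Fin n} (hs : s ∈ S) (ht : t ∈ S) (hst : s ≠ t) :
    {s, t, x} ∈ H := by
  by_contra hno
  have hsub : (S ×ˢ S).filter (fun p => {p.1, p.2, x} ∈ H) ⊆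
      (S.offDiag.erase (s, t)).erase (t, s) := by
    refine Finset.subset_erase.2 ⟨Finset.subset_erase.2 ⟨linkCount_filter_subset hH x, ?_⟩, ?_⟩
    · simp [hno]
    · rw [Finset.insert_comm] at hno
      simp [hno]
  have hcard := Finset.card_le_card hsub
  have h₁ : (s, t) ∈ S.offDiag := Finset.mem_offDiag.2 ⟨hs, ht, hst⟩
  have h₂ : (t, s) ∈ S.offDiag.erase (s, t) :=
    Finset.mem_erase.2 ⟨by simp [hst.symm], Finset.mem_offDiag.2 ⟨ht, hs, hst.symm⟩⟩
  rw [Finset.card_erase_of_mem h₂, Finset.card_erase_of_mem h₁, Finset.offDiag_card, hS] at hcard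
  unfold linkCount at hx
  omega

lemma pairColours_isFanoWeight (hH : Is3Graph H) (hF : FanoFree H) (hS : S.card = 5)
    (hind : ∀ t ⊆ S, t.card = 3 → t ∈ H) :
    IsFanoWeight Sᶜ (fun x y => (pairColours H S x y).card) (linkCount H S) where
  symm x y := by rw [(pairColours_isFanoColouring hH hF hS hind).symm]
  self x := by rw [(pairColours_isFanoColouring hH hF hS hind).self, Finset.card_empty]
  le_five x y := hS ▸ Finset.card_le_card (Finset.filter_subset _ _)
  vertex_le := linkCount_le hH hS
  vertex_add_le x hx y hy hxy := by
    by_contra! hlt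
    have hxl := linkCount_le hH hS x
    have hyl := linkCount_le hH hS y
    have fx := fun {s t : Fin n} => forall_mem_of_linkCount hH hS (x := x) (by omega) (s := s) (t := t)
    have fy := fun {s t : Fin n} => forall_mem_of_linkCount hH hS (x := y) (by omega) (s := s) (t := t)
    rw [Finset.mem_compl] at hx hy
    have hlen : S.toList.length = 5 := by rw [Finset.length_toList, hS]
    have hnd := S.nodup_toList
    have hmem : ∀ s, s ∈ S.toList → s ∈ S := fun s => Finset.mem_toList.1
    obtain ⟨s, p, q, t, u, hl⟩ : ∃ s p q t u, S.toList = [s, p, q, t, u] := by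
      match S.toList, hlen with
      | [s, p, q, t, u], _ => exact ⟨s, p, q, t, u, rfl⟩
    rw [hl] at hnd hmem
    simp only [List.mem_cons, List.not_mem_nil, or_false, forall_eq_or_imp, forall_eq] at hmem
    obtain ⟨hs, hp, hq, ht, hu⟩ := hmem
    have hne : ∀ {s v : Fin n}, s ∈ S → v ∉ S → v ≠ s := fun hs hv h => hv (h ▸ hs)
    have hxy' : {s, x, y} ∈ H := by
      have h := (pairColours_isFanoColouring hH hF hS hind).eq_of_card hxy
      rw [← h] at hs
      exact (Finset.mem_filter.1 hs).2
    have hxyne := (hH.ne_of_mem hxy').2.2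
    simp only [List.nodup_cons, List.mem_cons, List.not_mem_nil, or_false, not_or] at hnd
    obtain ⟨⟨sp, sq, st, su⟩, ⟨pq, pt, pu⟩, ⟨qt, qu⟩, tu, -⟩ := hnd
    refine hF.false_of_edges (a := x) (b := y) (c := s) (d := p) (e := q) (f := t) (g := u)
      ?_ ?_ (hind _ ?_ ?_) (fx hq ht qt) ?_ ?_ (hind _ ?_ ?_) ?_
    · simp [hxyne, sp, sq, st, su, pq, pt, pu, qt, qu, tu, hne hs hx, hne hp hx, hne hq hx,
        hne ht hx, hne hu hx, hne hs hy, hne hp hy, hne hq hy, hne ht hy, hne hu hy]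
    · rwa [Finset.insert_comm, Finset.pair_comm s y] at hxy'
    · simp [Finset.insert_subset_iff, hs, hp, hq]
    · exact Finset.card_eq_three.2 ⟨s, p, q, sp, sq, pq, rfl⟩
    · have := fx hu hp (Ne.symm pu)
      rwa [Finset.pair_comm, Finset.insert_comm] at this
    · have := fy hu hq (Ne.symm qu)
      rwa [Finset.pair_comm, Finset.insert_comm] at this
    · simp [Finset.insert_subset_iff, hs, hu, ht]
    · exact Finset.card_eq_three.2 ⟨s, u, t, su, st, Ne.symm tu, rfl⟩
    · have := fy hp ht pt
      rwa [Finset.pair_comm, Finset.insert_comm] at this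
  quad x hx y hy z hz t ht hxy hxz hxt hyz hyt hzt :=
    (pairColours_isFanoColouring hH hF hS hind).quadCond hx hy hz ht hxy hxz hxt hyz hyt hzt

lemma two_mul_vdeg3_le (hH : Is3Graph H) (s : Fin n) :
    2 * vdeg3 H s ≤ ∑ u : Fin n, ∑ v : Fin n, if {s, u, v} ∈ H then 1 else 0 := by
  rw [← Finset.sum_product', ← Finset.card_filter]
  set T := (Finset.univ ×ˢ Finset.univ : Finset (Fin n × Fin n)).filter
    fun p => ({s, p.1, p.2} : Finset (Fin n)) ∈ H with hT
  have hmaps : ∀ p ∈ T, ({s, p.1, p.2} : Finset (Fin n)) ∈ H.filter fun e => s ∈ e := by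
    intro p hp
    exact Finset.mem_filter.2 ⟨(Finset.mem_filter.1 hp).2, Finset.mem_insert_self _ _⟩
  rw [Finset.card_eq_sum_card_fiberwise hmaps, mul_comm, ← smul_eq_mul, vdeg3]
  refine Finset.card_nsmul_le_sum _ _ _ fun e he => ?_
  rw [Finset.mem_filter] at he
  have hc : (e.erase s).card = 2 := by rw [Finset.card_erase_of_mem he.2, hH e he.1]
  obtain ⟨a, b, hab, heq⟩ := Finset.card_eq_two.1 hc
  have he' : e = {s, a, b} := by rw [← Finset.insert_erase he.2, heq]
  have hab' : ((a, b) : Fin n × Fin n) ≠ (b, a) := by simp [hab]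
  rw [← Finset.card_pair hab']
  refine Finset.card_le_card fun p hp => ?_
  rw [Finset.mem_insert, Finset.mem_singleton] at hp
  rcases hp with rfl | rfl
  · simp [hT, ← he', he.1]
  · simp [hT, Finset.pair_comm b a, ← he', he.1]

/-- The edges at a vertex of `S`, split by their intersection with `S`. -/
lemma two_mul_vdeg3_le_split (hH : Is3Graph H) (hS : S.card = 5) {s : Fin n} (hs : s ∈ S) :
    2 * vdeg3 H s ≤ ∑ u ∈ Sᶜ, ∑ v ∈ Sᶜ, (if s ∈ pairColours H S u v then 1 else 0) +
      2 * ∑ v ∈ Sᶜ, ∑ u ∈ S, (if {s, u, v} ∈ H then 1 else 0) + 12 := by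
  have h := two_mul_vdeg3_le hH s
  have hin : ∑ u ∈ S, ∑ v ∈ S, (if {s, u, v} ∈ H then 1 else 0) ≤ 12 := by
    rw [← Finset.sum_product', ← Finset.card_filter]
    have hsub : (S ×ˢ S).filter (fun p => {s, p.1, p.2} ∈ H) ⊆ (S.erase s).offDiag := by
      rintro ⟨u, v⟩ huv
      simp only [Finset.mem_filter, Finset.mem_product] at huv
      obtain ⟨h1, h2, h3⟩ := hH.ne_of_mem huv.2
      exact Finset.mem_offDiag.2 ⟨Finset.mem_erase.2 ⟨h1.symm, huv.1.1⟩,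
        Finset.mem_erase.2 ⟨h2.symm, huv.1.2⟩, h3⟩
    have := Finset.card_le_card hsub
    rwa [Finset.offDiag_card, Finset.card_erase_of_mem hs, hS] at this
  have hout : ∀ u v, (if s ∈ pairColours H S u v then 1 else 0) =
      if ({s, u, v} : Finset (Fin n)) ∈ H then 1 else 0 := by
    intro u v
    simp [pairColours, hs]
  have hcross : ∑ u ∈ S, ∑ v ∈ Sᶜ, (if {s, u, v} ∈ H then 1 else 0) =
      ∑ v ∈ Sᶜ, ∑ u ∈ S, (if {s, u, v} ∈ H then 1 else 0) := Finset.sum_comm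
  have hcross' : ∑ u ∈ Sᶜ, ∑ v ∈ S, (if {s, u, v} ∈ H then 1 else 0) =
      ∑ v ∈ Sᶜ, ∑ u ∈ S, (if {s, u, v} ∈ H then 1 else 0) :=
    Finset.sum_congr rfl fun u _ => Finset.sum_congr rfl fun v _ => by rw [Finset.pair_comm]
  simp only [hout]
  have hsplit : ∀ f : Fin n → ℕ, ∑ u, f u = ∑ u ∈ S, f u + ∑ u ∈ Sᶜ, f u := fun f =>
    (Finset.sum_add_sum_compl S f).symm
  simp only [hsplit, Finset.sum_add_distrib] at h
  omega

lemma cross_sum_le (hH : Is3Graph H) (hS : S.card = 5) {s : Fin n} (hs : s ∈ S) :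
    ∑ v ∈ Sᶜ, ∑ u ∈ S, (if {s, u, v} ∈ H then 1 else 0) ≤ 4 * Sᶜ.card := by
  rw [mul_comm, ← smul_eq_mul]
  refine Finset.sum_le_card_nsmul _ _ _ fun v _ => ?_
  rw [← Finset.card_filter]
  have hsub : S.filter (fun u => {s, u, v} ∈ H) ⊆ S.erase s := fun u hu => by
    rw [Finset.mem_filter] at hu
    exact Finset.mem_erase.2 ⟨(hH.ne_of_mem hu.2).1.symm, hu.1⟩
  have := Finset.card_le_card hsub
  rwa [Finset.card_erase_of_mem hs, hS] at this

lemma two_mul_sum_vdeg3_le (hH : Is3Graph H) (hS : S.card = 5) :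
    2 * ∑ s ∈ S, vdeg3 H s ≤ ∑ u ∈ Sᶜ, ∑ v ∈ Sᶜ, (pairColours H S u v).card +
      2 * ∑ v ∈ Sᶜ, linkCount H S v + 60 := by
  have h := Finset.sum_le_sum fun s (hs : s ∈ S) => two_mul_vdeg3_le_split hH hS hs
  rw [← Finset.mul_sum, Finset.sum_add_distrib, Finset.sum_add_distrib, Finset.sum_const, hS,
    ← Finset.mul_sum] at h
  have h₁ : ∑ s ∈ S, ∑ u ∈ Sᶜ, ∑ v ∈ Sᶜ, (if s ∈ pairColours H S u v then 1 else 0) =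
      ∑ u ∈ Sᶜ, ∑ v ∈ Sᶜ, (pairColours H S u v).card := by
    rw [Finset.sum_comm]
    refine Finset.sum_congr rfl fun u _ => ?_
    rw [Finset.sum_comm]
    refine Finset.sum_congr rfl fun v _ => ?_
    rw [← Finset.card_filter, Finset.filter_mem_eq_inter,
      Finset.inter_eq_right.2 (show pairColours H S u v ⊆ S from Finset.filter_subset _ _)]
  have h₂ : ∑ s ∈ S, ∑ v ∈ Sᶜ, ∑ u ∈ S, (if {s, u, v} ∈ H then 1 else 0) =
      ∑ v ∈ Sᶜ, linkCount H S v := by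
    rw [Finset.sum_comm]
    refine Finset.sum_congr rfl fun v _ => ?_
    rw [linkCount, Finset.card_filter, Finset.sum_product]
  rw [h₁, h₂] at h
  simpa using h

lemma deg_sum_bound_of_noTopQuad {m D d Φ : ℝ} (h₁ : 2 * D ≤ Φ + 60) (h₂ : 5 * d ≤ D)
    (h₃ : 11 * Φ ≤ 37 * m ^ 2 + 455 * m) :
    34 * D + 6 * d ≤ 61 * (m + 5) * (m + 6) := by
  nlinarith [sq_nonneg (m - 16)]

lemma deg_sum_bound_of_topQuad {m D d Φ L k r M : ℝ} (h₁ : 2 * D ≤ Φ + 60)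
    (h₂ : 2 * d ≤ L + 8 * m + 12) (hk : 1 ≤ k) (hm : m = 4 * k + r) (hM : M + 4 ≤ m)
    (hL : 2 * L + M ^ 2 + 2 * m ≤ 2 * m ^ 2 + 2 * M)
    (hΦ : 11 * Φ ≤ 11 * (k * (13 * m + M + 150) + 14 * k * r) + (37 * r ^ 2 + 455 * r)) :
    34 * D + 6 * d ≤ 61 * (m + 5) * (m + 6) := by
  obtain ⟨N, rfl⟩ : ∃ N, M = m - 4 - N := ⟨m - 4 - M, by ring⟩
  subst hm
  nlinarith [sq_nonneg (N - r + 20 / 3), sq_nonneg (r - 29), mul_nonneg (sub_nonneg.2 hk)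
    (show 0 ≤ N by linarith)]

lemma deg_sum_bound {n : ℕ} {H : Finset (Finset (Fin n))} (hH : Is3Graph H) (hF : FanoFree H)
    {S : Finset (Fin n)} (hS : S.card = 5) (hind : ∀ t ⊆ S, t.card = 3 → t ∈ H) {d : ℕ}
    (hmin : ∀ v ∈ S, d ≤ vdeg3 H v) :
    34 * ((∑ v ∈ S, vdeg3 H v : ℕ) : ℝ) + 6 * d ≤ 61 * n * (n + 1) := by
  classical
  have hw := pairColours_isFanoWeight hH hF hS hind
  have hX := pairColours_isFanoColouring hH hF hS hind
  set w : Fin n → Fin n → ℕ := fun x y => (pairColours H S x y).card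
  set g := linkCount H S
  set V := Sᶜ with hV
  have hn : (n : ℝ) = (V.card : ℝ) + 5 := by
    have := Finset.card_add_card_compl S
    rw [hS, Fintype.card_fin] at this
    have h : (n : ℝ) = (5 + V.card : ℕ) := by rw [this]
    rw [h]
    push_cast
    ring
  have hsum : 2 * ∑ s ∈ S, vdeg3 H s ≤ ∑ u ∈ V, ∑ v ∈ V, w u v + 2 * ∑ v ∈ V, g v + 60 :=
    two_mul_sum_vdeg3_le hH hS
  have hfive : 5 * d ≤ ∑ s ∈ S, vdeg3 H s := by
    have := Finset.card_nsmul_le_sum S _ d hmin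
    rwa [hS, smul_eq_mul] at this
  rw [hn, show (V.card : ℝ) + 5 + 1 = V.card + 6 by ring]
  by_cases hT : NoTopQuad w V
  · have := hw.total_le_of_noTopQuad hT
    exact deg_sum_bound_of_noTopQuad (Φ := (∑ u ∈ V, ∑ v ∈ V, w u v + 2 * ∑ v ∈ V, g v : ℕ))
      (by exact_mod_cast hsum) (by exact_mod_cast hfive) (by exact_mod_cast this)
  obtain ⟨⟨x₁, x₂, y₁, y₂⟩, hq, hmax⟩ := Finset.exists_max_image
    ((V ×ˢ V ×ˢ V ×ˢ V).filter fun q => IsTopQuad w q.1 q.2.1 q.2.2.1 q.2.2.2)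
    (fun q => (senders w V q.1 q.2.1 q.2.2.1 q.2.2.2).card) (by
      simp only [NoTopQuad, not_forall, not_not] at hT
      obtain ⟨x₁, hx₁, x₂, hx₂, y₁, hy₁, y₂, hy₂, hQ⟩ := hT
      exact ⟨(x₁, x₂, y₁, y₂), by simp only [Finset.mem_filter, Finset.mem_product, hx₁, hx₂, hy₁, hy₂, hQ, and_self]⟩)
  simp only [Finset.mem_filter, Finset.mem_product] at hq
  obtain ⟨⟨hx₁, hx₂, hy₁, hy₂⟩, hQ⟩ := hq
  set M := senders w V x₁ x₂ y₁ y₂ with hM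
  have hMsub : M ⊆ V \ {x₁, x₂, y₁, y₂} := Finset.filter_subset _ _
  have hMcard : M.card + 4 ≤ V.card := by
    have h := Finset.card_le_card hMsub
    have hQV : ({x₁, x₂, y₁, y₂} : Finset (Fin n)) ⊆ V := by
      simp only [Finset.insert_subset_iff, Finset.singleton_subset_iff, hx₁, hx₂, hy₁, hy₂, and_self]
    have h' := Finset.card_le_card hQV
    rw [Finset.card_sdiff_of_subset hQV, hQ.card_eq_four] at h
    rw [hQ.card_eq_four] at h'
    omega
  obtain ⟨k, R, hR, hcard, hTR, hF₁, hF₂⟩ := hw.exists_peeling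
    (fun u => ∑ v ∈ V, w u v + 2 * g u) (13 * V.card + M.card + 150)
    (fun a ha b hb c hc e he hq => (hw.top_degree_le ha hb hc he hq).trans <| by
      have := hmax (a, b, c, e)
        (by simp only [Finset.mem_filter, Finset.mem_product, ha, hb, hc, he, hq, and_self])
      simp only at this
      omega) V subset_rfl
  have hk : 1 ≤ k := by
    by_contra! hk
    have hRV := Finset.eq_of_subset_of_card_le hR (by omega)
    exact hT (hRV ▸ hTR)
  have hR' := (hw.mono hR).total_le_of_noTopQuad hTR
  simp only [Finset.sum_add_distrib, ← Finset.mul_sum] at hF₁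
  obtain ⟨c, hc, P, hPM, hP, hP'⟩ := hX.exists_colour hw hx₁ hx₂ hy₁ hy₂ hQ
  have hL := hX.colour_count_le (hMsub.trans Finset.sdiff_subset) hPM hP hP'
  have hdc := two_mul_vdeg3_le_split hH hS hc
  have hcross := cross_sum_le hH hS hc
  have hdmin := hmin c hc
  rw [← hV] at hdc hcross
  set L := ∑ u ∈ V, ∑ v ∈ V, if c ∈ pairColours H S u v then 1 else 0
  have hd : 2 * d ≤ L + 8 * V.card + 12 := by omega
  have hΦ : 11 * (∑ u ∈ V, ∑ v ∈ V, w u v + 2 * ∑ v ∈ V, g v) ≤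
      11 * (k * (13 * V.card + M.card + 150) + 14 * k * R.card) +
        (37 * R.card ^ 2 + 455 * R.card) := by omega
  exact deg_sum_bound_of_topQuad (k := k) (r := R.card) (M := M.card) (L := L)
    (Φ := (∑ u ∈ V, ∑ v ∈ V, w u v + 2 * ∑ v ∈ V, g v : ℕ))
    (by exact_mod_cast hsum) (by exact_mod_cast hd) (by exact_mod_cast hk)
    (by exact_mod_cast hcard) (by exact_mod_cast hMcard) (by exact_mod_cast hL)
    (by exact_mod_cast hΦ)

end hypergraph

/-- If H is an 𝔽-free 3-graph on n vertices and S is a 5-set inducing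
a copy of K₅³ in H, then with `d_min = min_{v ∈ S} d_H(v)`:
`∑_{v ∈ S} d_H(v) + (3/17)·d_min ≤ 61n(n+1)/34`, and consequently
`d_min ≤ 61n(n+1)/176`. -/
theorem K53_deg_sum (n : ℕ) (H : Finset (Finset (Fin n))) (hH : Is3Graph H)
    (hF : FanoFree H) (S : Finset (Fin n)) (hS : S.card = 5)
    (hind : ∀ t ⊆ S, t.card = 3 → t ∈ H)
    (dmin : ℕ) (hmem : ∃ v ∈ S, vdeg3 H v = dmin) (hmin : ∀ v ∈ S, dmin ≤ vdeg3 H v) :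
    (∑ v ∈ S, (vdeg3 H v : ℝ)) + (3 / 17) * (dmin : ℝ) ≤ 61 * n * (n + 1) / 34 ∧
    (dmin : ℝ) ≤ 61 * n * (n + 1) / 176 := by
  have hsum := deg_sum_bound hH hF hS hind hmin
  have hfive := Finset.card_nsmul_le_sum S _ dmin hmin
  rw [hS, smul_eq_mul] at hfive
  have hfive' : 5 * (dmin : ℝ) ≤ ((∑ v ∈ S, vdeg3 H v : ℕ) : ℝ) := by exact_mod_cast hfive
  rw [← Nat.cast_sum]
  constructor <;> linarith
end

section
/- There exist a constant ε > 0 and an integer N such that the following holds for every n ≥ N. Suppose H is a 3-graph on n vertices containing a 5-set S = {v₁,…,v₅} ⊆ V(H) that induces a copy of K₅³ in H, and suppose d_{2,H}(vᵢ) ≥ (5/4 − ε)·n³ for each i ∈ {1,…,5}. Then H contains a subgraph isomorphic to the Fano plane 𝔽. -/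
section Analytic

open Finset

variable {V : Type*} [Fintype V]

theorem triangle_identity (a : V → V → ℝ) (hs : ∀ x y, a x y = a y x) :
    ∑ x, ∑ y, ∑ z, (1 - a x y) * (1 - a x z) * (1 - a y z) =
      (Fintype.card V : ℝ) ^ 3 - 3 * Fintype.card V * (∑ x, ∑ y, a x y)
        + 3 * ∑ x, (∑ y, a x y) ^ 2 - ∑ x, ∑ y, a x y * ∑ z, a x z * a y z := by
  have e1 : ∀ x y z, (1 - a x y) * (1 - a x z) * (1 - a y z) =
      1 - a x y - a x z - a y z + a x y * a x z + a y x * a y z + a z x * a z y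
        - a x y * (a x z * a y z) := by
    intro x y z
    rw [hs y x, hs z x, hs z y]; ring
  have s1 : ∑ x, ∑ y, ∑ z, a x y * a x z = ∑ x, (∑ y, a x y) ^ 2 := by
    simp only [sq, Finset.sum_mul_sum]
  have s2 : ∑ x, ∑ y, ∑ z, a y x * a y z = ∑ x, (∑ y, a x y) ^ 2 := by
    rw [Finset.sum_comm, ← s1]
  have s3 : ∑ x, ∑ y, ∑ z, a z x * a z y = ∑ x, (∑ y, a x y) ^ 2 := by
    rw [← s1, Finset.sum_comm_cycle]
  have t1 : ∑ x, ∑ y, ∑ _z : V, a x y = Fintype.card V * ∑ x, ∑ y, a x y := by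
    simp [Finset.mul_sum]
  have t2 : ∑ x, ∑ _y : V, ∑ z, a x z = Fintype.card V * ∑ x, ∑ y, a x y := by
    simp [Finset.mul_sum]
  have t3 : ∑ _x : V, ∑ y, ∑ z, a y z = Fintype.card V * ∑ x, ∑ y, a x y := by
    simp
  have u : ∑ _x : V, ∑ _y : V, ∑ _z : V, (1 : ℝ) = (Fintype.card V : ℝ) ^ 3 := by
    simp; ring
  have s4 : ∑ x, ∑ y, ∑ z, a x y * (a x z * a y z) = ∑ x, ∑ y, a x y * ∑ z, a x z * a y z := by
    simp only [Finset.mul_sum]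
  simp only [e1, Finset.sum_add_distrib, Finset.sum_sub_distrib, s1, s2, s3, s4, t1, t2, t3, u]
  ring

theorem sum_cherry_closed_le (b : V → V → ℝ) (h0 : ∀ x y, 0 ≤ b x y) (h1 : ∀ x y, b x y ≤ 1)
    {g : ℝ} (hg : 0 ≤ g) (hb : ∑ x, ∑ y, b x y = g ^ 2) :
    ∑ x, ∑ y, ∑ z, b x y * b x z * b y z ≤ g ^ 3 := by
  have key : ∀ x, ∑ y, ∑ z, b x y * b x z * b y z ≤ (∑ y, b x y) * g := by
    intro x
    have hd : 0 ≤ ∑ y, b x y := Finset.sum_nonneg fun y _ => h0 x y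
    by_cases hc : ∑ y, b x y ≤ g
    · calc ∑ y, ∑ z, b x y * b x z * b y z ≤ ∑ y, ∑ z, b x y * b x z := by
            refine Finset.sum_le_sum fun y _ => Finset.sum_le_sum fun z _ => ?_
            exact mul_le_of_le_one_right (mul_nonneg (h0 _ _) (h0 _ _)) (h1 _ _)
        _ = (∑ y, b x y) * ∑ y, b x y := by rw [Finset.sum_mul_sum]
        _ ≤ _ := by gcongr
    · calc ∑ y, ∑ z, b x y * b x z * b y z ≤ ∑ y, ∑ z, b y z := by
            refine Finset.sum_le_sum fun y _ => Finset.sum_le_sum fun z _ => ?_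
            exact mul_le_of_le_one_left (h0 _ _)
              (mul_le_one₀ (h1 _ _) (h0 _ _) (h1 _ _))
        _ = g * g := by rw [hb, sq]
        _ ≤ _ := by gcongr; exact (not_le.mp hc).le
  calc _ ≤ ∑ x, (∑ y, b x y) * g := Finset.sum_le_sum fun x _ => key x
    _ = g ^ 3 := by rw [← Finset.sum_mul, hb]; ring

theorem codegree_sq_le (a h : V → V → ℝ) (ha : ∀ x y, a x y = 0 ∨ a x y = 1)
    {m ρ : ℝ} (hm : ∀ x y, h x y ≤ m) (hρ : 0 ≤ ρ)
    (x y : V)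
    (hk : ∀ z u, a x z = 1 → a y z = 1 → a x u = 1 → a y u = 1 → a z u = 1 →
      ρ ≤ (m - h x z) + (m - h y z) + ((m - h x u) + (m - h y u))) :
    ρ * ((∑ z, a x z * a y z) ^ 2 - ∑ z, ∑ u, (1 - a z u)) ≤
      2 * (∑ z, a x z * a y z) * (∑ z, a x z * (m - h x z) + ∑ z, a y z * (m - h y z)) := by
  have h0 : ∀ x y, 0 ≤ a x y := fun x y => by rcases ha x y with h | h <;> simp [h]
  have h1 : ∀ x y, a x y ≤ 1 := fun x y => by rcases ha x y with h | h <;> simp [h]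
  set c : V → ℝ := fun z => a x z * a y z with hc
  set e : V → ℝ := fun z => (m - h x z) + (m - h y z) with he
  have c0 : ∀ z, 0 ≤ c z := fun z => mul_nonneg (h0 _ _) (h0 _ _)
  have c1 : ∀ z, c z ≤ 1 := fun z => mul_le_one₀ (h1 _ _) (h0 _ _) (h1 _ _)
  have e0 : ∀ z, 0 ≤ e z := fun z => by simp only [he]; linarith [hm x z, hm y z]
  have A1 : (∑ z, c z) ^ 2 - ∑ z, ∑ u, (1 - a z u) ≤ ∑ z, ∑ u, c z * c u * a z u := by
    rw [sq, Finset.sum_mul_sum, ← Finset.sum_sub_distrib]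
    gcongr with z _
    rw [← Finset.sum_sub_distrib]
    gcongr with u _
    have := mul_le_one₀ (c1 z) (c0 u) (c1 u)
    nlinarith [h1 z u, h0 z u]
  have A2 : ρ * ∑ z, ∑ u, c z * c u * a z u ≤ ∑ z, ∑ u, c z * c u * (e z + e u) := by
    simp only [Finset.mul_sum]
    refine Finset.sum_le_sum fun z _ => Finset.sum_le_sum fun u _ => ?_
    have hn : 0 ≤ c z * c u * (e z + e u) :=
      mul_nonneg (mul_nonneg (c0 z) (c0 u)) (add_nonneg (e0 z) (e0 u))
    rcases ha x z with h | h2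
    · simp [hc, h]
    rcases ha y z with h | h3
    · simp [hc, h]
    rcases ha x u with h | h4
    · simp [hc, h]
    rcases ha y u with h | h5
    · simp [hc, h]
    rcases ha z u with h | h6
    · rw [h]; simpa using hn
    have := hk z u h2 h3 h4 h5 h6
    simpa [hc, he, h2, h3, h4, h5, h6] using this
  have A3 : ∑ z, ∑ u, c z * c u * (e z + e u) = 2 * (∑ z, c z) * ∑ z, c z * e z := by
    have r1 : (∑ z, c z * e z) * ∑ z, c z = ∑ z, ∑ u, c z * c u * e z := by
      rw [Finset.sum_mul_sum]
      exact Finset.sum_congr rfl fun z _ => Finset.sum_congr rfl fun u _ => by ring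
    have r2 : (∑ z, c z) * (∑ z, c z * e z) = ∑ z, ∑ u, c z * c u * e u := by
      rw [Finset.sum_mul_sum]
      exact Finset.sum_congr rfl fun z _ => Finset.sum_congr rfl fun u _ => by ring
    simp only [mul_add, Finset.sum_add_distrib]
    rw [← r1, ← r2]; ring
  have A4 : ∑ z, c z * e z ≤ ∑ z, a x z * (m - h x z) + ∑ z, a y z * (m - h y z) := by
    rw [← Finset.sum_add_distrib]
    gcongr with z _
    have k1 := mul_le_mul_of_nonneg_right
      (mul_le_of_le_one_right (h0 x z) (h1 y z)) (sub_nonneg.2 (hm x z))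
    have k2 := mul_le_mul_of_nonneg_right
      (mul_le_of_le_one_left (h0 y z) (h1 x z)) (sub_nonneg.2 (hm y z))
    simp only [hc, he]; linarith
  calc _ ≤ ρ * ∑ z, ∑ u, c z * c u * a z u := by gcongr
    _ ≤ _ := A2
    _ = _ := A3
    _ ≤ _ := by
      have := Finset.sum_nonneg fun z (_ : z ∈ univ) => c0 z
      gcongr

theorem triangle_sq_le (a h : V → V → ℝ) (ha : ∀ x y, a x y = 0 ∨ a x y = 1)
    (hs : ∀ x y, a x y = a y x)
    {m ρ : ℝ} (hm : ∀ x y, h x y ≤ m) (hρ : 0 ≤ ρ)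
    (hk : ∀ x y z u, a x y = 1 → a x z = 1 → a y z = 1 → a x u = 1 → a y u = 1 → a z u = 1 →
      ρ ≤ (m - h x z) + (m - h y z) + ((m - h x u) + (m - h y u))) :
    ρ * ((∑ x, ∑ y, a x y * ∑ z, a x z * a y z) ^ 2
        - (∑ x, ∑ y, a x y) ^ 2 * ∑ z, ∑ u, (1 - a z u)) ≤
      4 * (∑ x, ∑ y, a x y * (m - h x y)) * (∑ x, ∑ y, a x y) ^ 2 := by
  have h0 : ∀ x y, 0 ≤ a x y := fun x y => by rcases ha x y with h | h <;> simp [h]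
  have h1 : ∀ x y, a x y ≤ 1 := fun x y => by rcases ha x y with h | h <;> simp [h]
  set w : V → V → ℝ := fun x y => ∑ z, a x z * a y z with hw
  set δ : V → ℝ := fun x => ∑ z, a x z * (m - h x z) with hδ
  set A := ∑ x, ∑ y, a x y with hA
  set B := ∑ z, ∑ u, (1 - a z u) with hB
  have w0 : ∀ x y, 0 ≤ w x y := fun x y =>
    Finset.sum_nonneg fun z _ => mul_nonneg (h0 _ _) (h0 _ _)
  have δ0 : ∀ x, 0 ≤ δ x := fun x =>
    Finset.sum_nonneg fun z _ => mul_nonneg (h0 _ _) (sub_nonneg.2 (hm _ _))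
  have A0 : 0 ≤ A := Finset.sum_nonneg fun x _ => Finset.sum_nonneg fun y _ => h0 x y
  have E : ∀ x y, ρ * (a x y * w x y ^ 2 - a x y * B) ≤ 2 * (a x y * w x y * (δ x + δ y)) := by
    intro x y
    rcases ha x y with h | hxy
    · simp [h]
    · have := codegree_sq_le a h ha hm hρ x y fun z u => hk x y z u hxy
      rw [hxy]; simp only [one_mul]
      rw [← mul_assoc]; exact this
  have S1 : ρ * (∑ x, ∑ y, a x y * w x y ^ 2 - A * B) ≤
      2 * ∑ x, ∑ y, a x y * w x y * (δ x + δ y) := by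
    simp only [hA, Finset.sum_mul, ← Finset.sum_sub_distrib, Finset.mul_sum]
    exact Finset.sum_le_sum fun x _ => Finset.sum_le_sum fun y _ => E x y
  have wd : ∀ x y, w x y ≤ ∑ z, a y z := fun x y =>
    Finset.sum_le_sum fun z _ => mul_le_of_le_one_left (h0 _ _) (h1 _ _)
  have S2 : ∑ x, ∑ y, a x y * w x y * δ x ≤ (∑ x, δ x) * A := by
    rw [hA, Finset.sum_mul_sum]
    refine Finset.sum_le_sum fun x _ => Finset.sum_le_sum fun y _ => ?_
    rw [mul_comm]
    exact mul_le_mul_of_nonneg_left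
      ((mul_le_of_le_one_left (w0 _ _) (h1 _ _)).trans (wd x y)) (δ0 x)
  have S3 : ∑ x, ∑ y, a x y * w x y * δ y ≤ (∑ x, δ x) * A := by
    rw [Finset.sum_comm]
    refine le_trans (le_of_eq ?_) S2
    refine Finset.sum_congr rfl fun x _ => Finset.sum_congr rfl fun y _ => ?_
    rw [hs y x]
    simp only [hw]
    congr 2
    exact Finset.sum_congr rfl fun z _ => mul_comm _ _
  have S4 : (∑ x, ∑ y, a x y * w x y) ^ 2 ≤ A * ∑ x, ∑ y, a x y * w x y ^ 2 := by
    simp only [hA, ← Fintype.sum_prod_type']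
    have := Finset.sum_mul_sq_le_sq_mul_sq (univ : Finset (V × V)) (fun p => a p.1 p.2)
      (fun p => a p.1 p.2 * w p.1 p.2)
    have q : ∀ p : V × V, a p.1 p.2 * a p.1 p.2 = a p.1 p.2 := fun p => by
      rcases ha p.1 p.2 with h | h <;> simp [h]
    simp only [mul_pow, ← mul_assoc, q, sq (a _ _)] at this
    exact this
  have S5 : ρ * (∑ x, ∑ y, a x y * w x y ^ 2 - A * B) ≤ 4 * (∑ x, δ x) * A := by
    have : ∑ x, ∑ y, a x y * w x y * (δ x + δ y) =
        ∑ x, ∑ y, a x y * w x y * δ x + ∑ x, ∑ y, a x y * w x y * δ y := by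
      simp only [mul_add, Finset.sum_add_distrib]
    linarith
  calc _ ≤ ρ * (A * ∑ x, ∑ y, a x y * w x y ^ 2 - A ^ 2 * B) := by gcongr
    _ = A * (ρ * (∑ x, ∑ y, a x y * w x y ^ 2 - A * B)) := by ring
    _ ≤ A * (4 * (∑ x, δ x) * A) := by gcongr
    _ = _ := by ring

theorem density_contradiction {α ψ D t g : ℝ} (hg : 0 ≤ g) (hgα : g ^ 2 = 1 - α)
    (hα : α ≤ 70005 / 100000) (hα' : 62 / 100 ≤ α) (hD : 0 ≤ D)
    (ht : 1 - 3 * α + 3 * ψ - g ^ 3 ≤ t) (hψ : 5 / 4 - 1 / 1000000 ≤ ψ + α - D)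
    (htt : 31 / 40 * (t ^ 2 - α ^ 2 * g ^ 2) ≤ 4 * (D * α ^ 2)) : False := by
  obtain rfl : α = 1 - g ^ 2 := by linarith
  have g1 : 547676 / 1000000 ≤ g := by nlinarith
  have g2 : g ≤ 617 / 1000 := by nlinarith
  obtain ⟨P, hP⟩ : ∃ P, P = 6 * g ^ 2 - 5 / 4 - 3 / 1000000 - g ^ 3 := ⟨_, rfl⟩
  have hc : g ^ 2 * g = g ^ 3 := by ring
  have hPa : (1 - g ^ 2) * g + 201 / 100000 ≤ P := by nlinarith
  have hG : 382 / 1000 ≤ (1 - g ^ 2) * g := by nlinarith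
  have htP : P + 3 * D ≤ t := by linarith
  have h1 : (P + 3 * D) ^ 2 ≤ t ^ 2 := by
    have : 0 ≤ P := by linarith
    gcongr
  have h2 : (1 - g ^ 2) ^ 2 ≤ 490071 / 1000000 := by
    have : 0 ≤ 1 - g ^ 2 := by linarith
    nlinarith
  have h3 : D * (1 - g ^ 2) ^ 2 ≤ D * (490071 / 1000000) := by gcongr
  have h4 : 201 / 100000 * (766 / 1000) ≤ P ^ 2 - ((1 - g ^ 2) * g) ^ 2 := by
    calc _ ≤ (P - (1 - g ^ 2) * g) * (P + (1 - g ^ 2) * g) := by gcongr <;> linarith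
      _ = _ := by ring
  have h5 : D * (384 / 1000) ≤ D * P := by gcongr; linarith
  have h6 : (1 - g ^ 2) ^ 2 * g ^ 2 = ((1 - g ^ 2) * g) ^ 2 := by ring
  rw [h6] at htt
  linarith [sq_nonneg (D - 126 / 10000), add_sq P (3 * D), mul_pow 3 D 2]

theorem scaled_density_contradiction {m A Ψ D t g : ℝ} (hm : 0 < m) (hg : 0 ≤ g)
    (hgA : g ^ 2 = m ^ 2 - A) (hA : A ≤ 70005 / 100000 * m ^ 2) (hA' : 62 / 100 * m ^ 2 ≤ A)
    (hD : 0 ≤ D) (ht : m ^ 3 - 3 * m * A + 3 * Ψ - t ≤ g ^ 3)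
    (hΨ : (5 / 4 - 1 / 1000000) * m ^ 3 ≤ Ψ + (m * A - D))
    (htt : 31 / 40 * m * (t ^ 2 - A ^ 2 * g ^ 2) ≤ 4 * D * A ^ 2) : False := by
  have h0 := hm.ne'
  obtain ⟨α, rfl⟩ : ∃ α, A = α * m ^ 2 := ⟨A / m ^ 2, by field_simp⟩
  obtain ⟨ψ, rfl⟩ : ∃ ψ, Ψ = ψ * m ^ 3 := ⟨Ψ / m ^ 3, by field_simp⟩
  obtain ⟨δ, rfl⟩ : ∃ δ, D = δ * m ^ 3 := ⟨D / m ^ 3, by field_simp⟩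
  obtain ⟨τ, rfl⟩ : ∃ τ, t = τ * m ^ 3 := ⟨t / m ^ 3, by field_simp⟩
  obtain ⟨γ, rfl⟩ : ∃ γ, g = γ * m := ⟨g / m, by field_simp⟩
  have m2 := pow_pos hm 2
  have m3 := pow_pos hm 3
  have m7 := pow_pos hm 7
  refine density_contradiction (α := α) (ψ := ψ) (D := δ) (t := τ) (g := γ)
    (nonneg_of_mul_nonneg_left hg hm) (mul_right_cancel₀ m2.ne' ?_)
    (le_of_mul_le_mul_right hA m2) (le_of_mul_le_mul_right hA' m2)
    (nonneg_of_mul_nonneg_left hD m3) (le_of_mul_le_mul_right ?_ m3)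
    (le_of_mul_le_mul_right ?_ m3) (le_of_mul_le_mul_right ?_ m7)
  · linear_combination hgA
  · linear_combination ht
  · linear_combination hΨ
  · linear_combination htt

end Analytic

section Multigraph

variable {V : Type*}

/-- Three matchings of a weighted `K₄` cannot be given weights at least `6`, `7`, `8`. -/
def MatchingBounded (p q r : ℕ) : Prop :=
  ¬ (6 ≤ p ∧ 7 ≤ q ∧ 8 ≤ r) ∧ ¬ (6 ≤ p ∧ 7 ≤ r ∧ 8 ≤ q) ∧ ¬ (6 ≤ q ∧ 7 ≤ p ∧ 8 ≤ r) ∧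
    ¬ (6 ≤ q ∧ 7 ≤ r ∧ 8 ≤ p) ∧ ¬ (6 ≤ r ∧ 7 ≤ p ∧ 8 ≤ q) ∧ ¬ (6 ≤ r ∧ 7 ≤ q ∧ 8 ≤ p)

theorem matchingBounded_of_forall {w : V → V → ℕ} (hs : ∀ x y, w x y = w y x) {U : Finset V}
    (hf : ∀ a ∈ U, ∀ b ∈ U, ∀ c ∈ U, ∀ d ∈ U, a ≠ b → a ≠ c → a ≠ d → b ≠ c → b ≠ d → c ≠ d →
      6 ≤ w a b + w c d → 7 ≤ w a c + w b d → 8 ≤ w a d + w b c → False)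
    {a b c d : V} (ha : a ∈ U) (hb : b ∈ U) (hc : c ∈ U) (hd : d ∈ U)
    (hab : a ≠ b) (hac : a ≠ c) (had : a ≠ d) (hbc : b ≠ c) (hbd : b ≠ d) (hcd : c ≠ d) :
    MatchingBounded (w a b + w c d) (w a c + w b d) (w a d + w b c) := by
  have h1 := hf a ha b hb c hc d hd hab hac had hbc hbd hcd
  have h2 := hf a ha b hb d hd c hc hab had hac hbd hbc hcd.symm
  have h3 := hf a ha c hc b hb d hd hac hab had hbc.symm hcd hbd
  have h4 := hf a ha c hc d hd b hb hac had hab hcd hbc.symm hbd.symm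
  have h5 := hf a ha d hd b hb c hc had hab hac hbd.symm hcd.symm hbc
  have h6 := hf a ha d hd c hc b hb had hac hab hcd.symm hbd.symm hbc.symm
  simp only [hs d c, hs c b, hs d b] at h1 h2 h3 h4 h5 h6
  exact ⟨fun h => h1 h.1 h.2.1 h.2.2, fun h => h2 h.1 h.2.1 h.2.2, fun h => h3 h.1 h.2.1 h.2.2,
    fun h => h4 h.1 h.2.1 h.2.2, fun h => h5 h.1 h.2.1 h.2.2, fun h => h6 h.1 h.2.1 h.2.2⟩

theorem four_cycle_weights {va vb vc vd ab bc cd da ac : ℕ} (h1 : va ≤ 5) (h2 : vb ≤ 5)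
    (h3 : vc ≤ 5) (h4 : vd ≤ 5) (h5 : ab ≤ 5) (h6 : bc ≤ 5) (h7 : cd ≤ 5) (h8 : da ≤ 5)
    (hac : 3 ≤ ac) (hcyc : 19 ≤ ab + bc + cd + da)
    (t1 : ¬ (va = 5 ∧ vb = 5 ∧ ab = 5)) (t2 : ¬ (vb = 5 ∧ vc = 5 ∧ bc = 5))
    (t3 : ¬ (vc = 5 ∧ vd = 5 ∧ cd = 5)) (t4 : ¬ (va = 5 ∧ vd = 5 ∧ da = 5))
    (hb : MatchingBounded (va + bc) (vb + ac) (vc + ab))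
    (hd : MatchingBounded (va + cd) (vc + da) (vd + ac)) :
    va + vb + vc + vd ≤ 14 := by
  obtain ⟨f1, f2, f3, f4, f5, f6⟩ := hb
  obtain ⟨g1, g2, g3, g4, g5, g6⟩ := hd
  by_contra hcon
  interval_cases va <;> interval_cases vc <;> omega

theorem no_expansion {w : V → V → ℕ} (h5 : ∀ x y, w x y ≤ 5) (hs : ∀ x y, w x y = w y x)
    {U : Finset V}
    (hf : ∀ a ∈ U, ∀ b ∈ U, ∀ c ∈ U, ∀ d ∈ U, a ≠ b → a ≠ c → a ≠ d → b ≠ c → b ≠ d → c ≠ d →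
      6 ≤ w a b + w c d → 7 ≤ w a c + w b d → 8 ≤ w a d + w b c → False)
    (e2 : ∀ x ∈ U, ∀ y ∈ U, x ≠ y → ∃ z ∈ U, z ≠ x ∧ z ≠ y ∧ 8 ≤ w z x + w z y)
    (e3 : ∀ x ∈ U, ∀ y ∈ U, ∀ z ∈ U, x ≠ y → x ≠ z → y ≠ z →
      ∃ u ∈ U, u ≠ x ∧ u ≠ y ∧ u ≠ z ∧ 11 ≤ w u x + w u y + w u z)
    (e4 : ∀ a ∈ U, ∀ b ∈ U, ∀ c ∈ U, ∀ d ∈ U, a ≠ b → a ≠ c → a ≠ d → b ≠ c → b ≠ d → c ≠ d →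
      ∃ v ∈ U, v ≠ a ∧ v ≠ b ∧ v ≠ c ∧ v ≠ d ∧ 15 ≤ w v a + w v b + w v c + w v d) :
    ∀ x ∈ U, ∀ y ∈ U, x ≠ y → w x y ≤ 3 := by
  intro x₀ hx₀ y₀ hy₀ hxy₀
  by_contra! hw₀
  have hM := fun {a b c d : V} => matchingBounded_of_forall hs hf (a := a) (b := b) (c := c) (d := d)
  by_cases h555 : ∃ a ∈ U, ∃ b ∈ U, ∃ c ∈ U, a ≠ b ∧ a ≠ c ∧ b ≠ c ∧
      w a b = 5 ∧ w a c = 5 ∧ w b c = 5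
  · obtain ⟨a, ha, b, hb, c, hc, hab, hac, hbc, wab, wac, wbc⟩ := h555
    obtain ⟨u, hu, hua, hub, huc, hsum⟩ := e3 a ha b hb c hc hab hac hbc
    have hm := hM hu ha hb hc hua hub huc hab hac hbc
    unfold MatchingBounded at hm
    have := h5 u a
    have := h5 u b
    have := h5 u c
    omega
  push Not at h555
  by_cases hfive : ∃ x ∈ U, ∃ y ∈ U, x ≠ y ∧ w x y = 5
  · obtain ⟨x, hx, y, hy, hxy, wxy⟩ := hfive
    obtain ⟨z, hz, hzx, hzy, hzsum⟩ := e2 x hx y hy hxy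
    obtain ⟨u, hu, hux, huy, huz, husum⟩ := e3 x hx y hy z hz hxy hzx.symm hzy.symm
    have cyc : ∀ a ∈ U, ∀ b ∈ U, ∀ c ∈ U, ∀ d ∈ U,
        a ≠ b → a ≠ c → a ≠ d → b ≠ c → b ≠ d → c ≠ d →
        ¬ (19 ≤ w a b + w b c + w c d + w a d ∧ 3 ≤ w a c) := by
      rintro a ha b hb c hc d hd hab hac had hbc hbd hcd ⟨hcyc, hdiag⟩
      obtain ⟨v, hv, hva, hvb, hvc, hvd, hvsum⟩ := e4 a ha b hb c hc d hd hab hac had hbc hbd hcd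
      have := four_cycle_weights (h5 v a) (h5 v b) (h5 v c) (h5 v d) (h5 a b) (h5 b c) (h5 c d)
        (h5 a d) hdiag hcyc
        (fun h => h555 v hv a ha b hb hva hvb hab h.1 h.2.1 h.2.2)
        (fun h => h555 v hv b hb c hc hvb hvc hbc h.1 h.2.1 h.2.2)
        (fun h => h555 v hv c hc d hd hvc hvd hcd h.1 h.2.1 h.2.2)
        (fun h => h555 v hv a ha d hd hva hvd had h.1 h.2.1 h.2.2)
        (hM hv ha hb hc hva hvb hvc hab hac hbc)
        (hM hv ha hc hd hva hvc hvd hac had hcd)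
      omega
    have hm := hM hu hx hy hz hux huy huz hxy hzx.symm hzy.symm
    have c1 := cyc x hx z hz y hy u hu hzx.symm hxy hux.symm hzy huz.symm huy.symm
    have c2 := cyc x hx y hy z hz u hu hxy hzx.symm hux.symm hzy.symm huy.symm huz.symm
    have c3 := cyc y hy x hx z hz u hu hxy.symm hzy.symm huy.symm hzx.symm hux.symm huz.symm
    have t := h555 x hx y hy z hz hxy hzx.symm hzy.symm wxy
    simp only [hs y x, hs z x, hs z y, hs x u, hs y u, hs z u] at *
    unfold MatchingBounded at hm
    have := h5 u x
    have := h5 u y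
    have := h5 u z
    have := h5 x z
    have := h5 y z
    interval_cases w x z <;> interval_cases w y z <;> omega
  · push Not at hfive
    obtain ⟨z, hz, hzx, hzy, hzsum⟩ := e2 x₀ hx₀ y₀ hy₀ hxy₀
    obtain ⟨u, hu, hux, huy, huz, husum⟩ := e3 x₀ hx₀ y₀ hy₀ z hz hxy₀ hzx.symm hzy.symm
    have four : ∀ a ∈ U, ∀ b ∈ U, a ≠ b → w a b ≤ 4 := fun a ha b hb hab =>
      Nat.le_of_lt_succ ((h5 a b).lt_of_ne (hfive a ha b hb hab))
    have hm := hM hu hx₀ hy₀ hz hux huy huz hxy₀ hzx.symm hzy.symm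
    rw [hs z x₀, hs z y₀] at hzsum
    have := four x₀ hx₀ y₀ hy₀ hxy₀
    have := four x₀ hx₀ z hz hzx.symm
    have := four y₀ hy₀ z hz hzy.symm
    have := four u hu x₀ hx₀ hux
    have := four u hu y₀ hy₀ huy
    have := four u hu z hz huz
    unfold MatchingBounded at hm
    omega

theorem sum_le_of_removal [DecidableEq V] {w : V → V → ℕ} (h5 : ∀ x y, w x y ≤ 5) (hs : ∀ x y, w x y = w y x)
    (hd : ∀ x, w x x = 0) {U R : Finset V} (hR : R ⊆ U) (hR4 : R.card ≤ 4)
    (hcross : ∀ v ∈ U \ R, 2 * ∑ r ∈ R, w v r ≤ 7 * R.card)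
    (ih : 2 * ∑ x ∈ U \ R, ∑ y ∈ U \ R, w x y ≤ 7 * (U \ R).card ^ 2 + 12 * (U \ R).card) :
    2 * ∑ x ∈ U, ∑ y ∈ U, w x y ≤ 7 * U.card ^ 2 + 12 * U.card := by
  have hcard := Finset.card_sdiff_add_card_eq_card hR
  have hsplit : ∑ x ∈ U, ∑ y ∈ U, w x y = ∑ x ∈ U \ R, ∑ y ∈ U \ R, w x y
      + 2 * (∑ x ∈ U \ R, ∑ r ∈ R, w x r) + ∑ x ∈ R, ∑ y ∈ R, w x y := by
    have hsym : ∑ x ∈ R, ∑ y ∈ U \ R, w x y = ∑ x ∈ U \ R, ∑ r ∈ R, w x r := by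
      rw [Finset.sum_comm]
      exact Finset.sum_congr rfl fun x _ => Finset.sum_congr rfl fun y _ => hs _ _
    simp only [← Finset.sum_sdiff hR, Finset.sum_add_distrib, hsym]
    ring
  have hC : 2 * ∑ x ∈ U \ R, ∑ r ∈ R, w x r ≤ (U \ R).card * (7 * R.card) := by
    rw [Finset.mul_sum, ← smul_eq_mul]
    exact Finset.sum_le_card_nsmul _ _ _ hcross
  have hRR : ∑ x ∈ R, ∑ y ∈ R, w x y ≤ R.card * ((R.card - 1) * 5) := by
    rw [← smul_eq_mul]
    refine Finset.sum_le_card_nsmul _ _ _ fun x hx => ?_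
    rw [← Finset.add_sum_erase _ _ hx, hd, zero_add, ← Finset.card_erase_of_mem hx, ← smul_eq_mul]
    exact Finset.sum_le_card_nsmul _ _ _ fun y _ => h5 x y
  rw [hsplit, ← hcard]
  generalize ∑ x ∈ U \ R, ∑ y ∈ U \ R, w x y = p at *
  generalize ∑ x ∈ U \ R, ∑ r ∈ R, w x r = q at *
  generalize ∑ x ∈ R, ∑ y ∈ R, w x y = r at *
  generalize (U \ R).card = m at *
  generalize R.card = k at *
  interval_cases k <;> norm_num at hRR hC <;> nlinarith

theorem weight_sum_le [DecidableEq V] {w : V → V → ℕ} (h5 : ∀ x y, w x y ≤ 5) (hs : ∀ x y, w x y = w y x)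
    (hd : ∀ x, w x x = 0) {U : Finset V}
    (hf : ∀ a ∈ U, ∀ b ∈ U, ∀ c ∈ U, ∀ d ∈ U, a ≠ b → a ≠ c → a ≠ d → b ≠ c → b ≠ d → c ≠ d →
      6 ≤ w a b + w c d → 7 ≤ w a c + w b d → 8 ≤ w a d + w b c → False) :
    2 * ∑ x ∈ U, ∑ y ∈ U, w x y ≤ 7 * U.card ^ 2 + 12 * U.card := by
  induction U using Finset.strongInduction with
  | H U ih =>
    by_contra hcon
    have hex : ∀ R ⊆ U, R.Nonempty → R.card ≤ 4 →
        ∃ v ∈ U, v ∉ R ∧ 7 * R.card < 2 * ∑ r ∈ R, w v r := by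
      intro R hR hne h4
      by_contra! hno
      refine hcon (sum_le_of_removal h5 hs hd hR h4 (fun v hv => ?_) (ih _ ?_ ?_))
      · obtain ⟨h1, h2⟩ := Finset.mem_sdiff.1 hv
        exact hno v h1 h2
      · exact Finset.sdiff_ssubset hR hne
      · intro a ha b hb c hc d hd
        exact hf a (Finset.sdiff_subset ha) b (Finset.sdiff_subset hb) c (Finset.sdiff_subset hc) d
          (Finset.sdiff_subset hd)
    have hle := no_expansion h5 hs hf
      (fun x hx y hy hxy => by
        obtain ⟨v, hv, hvR, hlt⟩ := hex {x, y} (by grind) (by simp) (by simp [hxy])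
        simp [hxy] at hvR hlt
        exact ⟨v, hv, hvR.1, hvR.2, by omega⟩)
      (fun x hx y hy z hz hxy hxz hyz => by
        obtain ⟨v, hv, hvR, hlt⟩ := hex {x, y, z} (by grind) (by simp)
          (by simp [hxy, hxz, hyz])
        simp [hxy, hxz, hyz] at hvR hlt
        exact ⟨v, hv, hvR.1, hvR.2.1, hvR.2.2, by omega⟩)
      (fun a ha b hb c hc d hd hab hac had hbc hbd hcd => by
        obtain ⟨v, hv, hvR, hlt⟩ := hex {a, b, c, d} (by grind) (by simp)
          (by simp [hab, hac, had, hbc, hbd, hcd])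
        simp [hab, hac, had, hbc, hbd, hcd] at hvR hlt
        exact ⟨v, hv, hvR.1, hvR.2.1, hvR.2.2.1, hvR.2.2.2, by omega⟩)
    refine hcon ?_
    have : ∑ x ∈ U, ∑ y ∈ U, w x y ≤ U.card * (U.card * 3) := by
      simp only [← smul_eq_mul]
      refine Finset.sum_le_card_nsmul _ _ _ fun x hx => Finset.sum_le_card_nsmul _ _ _ fun y hy => ?_
      by_cases h : x = y
      · simp [h, hd]
      · exact hle x hx y hy h
    nlinarith

end Multigraph

section Fano

variable {n : ℕ} {H : Finset (Finset (Fin n))}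

theorem not_fanoFree_of_lines (hH : Is3Graph H) (f : Fin 7 → Fin n)
    (h : ∀ e ∈ fanoEdges, e.image f ∈ H) : ¬ FanoFree H := by
  refine fun hfree => hfree ⟨f, fun i j hij => ?_, h⟩
  have hline : ∀ i j : Fin 7, ∃ e ∈ fanoEdges, e.card = 3 ∧ i ∈ e ∧ j ∈ e := by decide
  obtain ⟨e, he, hcard, hi, hj⟩ := hline i j
  exact Finset.card_image_iff.1 ((hH _ (h e he)).trans hcard.symm) hi hj hij

theorem not_fanoFree_of_mem (hH : Is3Graph H) {p₀ p₁ p₂ p₃ p₄ p₅ p₆ : Fin n}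
    (h₁ : {p₀, p₁, p₂} ∈ H) (h₂ : {p₂, p₃, p₄} ∈ H) (h₃ : {p₄, p₅, p₀} ∈ H)
    (h₄ : {p₀, p₆, p₃} ∈ H) (h₅ : {p₁, p₆, p₄} ∈ H) (h₆ : {p₂, p₆, p₅} ∈ H)
    (h₇ : {p₁, p₃, p₅} ∈ H) : ¬ FanoFree H := by
  refine not_fanoFree_of_lines hH ![p₀, p₁, p₂, p₃, p₄, p₅, p₆] ?_
  simp [fanoEdges, Finset.image_insert]
  exact ⟨h₁, h₂, h₃, h₄, h₅, h₆, h₇⟩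

theorem pairwise_ne_of_mem (hH : Is3Graph H) {x y z : Fin n} (h : {x, y, z} ∈ H) :
    x ≠ y ∧ x ≠ z ∧ y ≠ z := by
  have h3 := hH _ h
  refine ⟨?_, ?_, ?_⟩ <;> rintro rfl
  · rw [Finset.insert_eq_of_mem (by simp)] at h3
    exact absurd h3 (Finset.card_le_two.trans_lt (by norm_num)).ne
  · rw [Finset.insert_eq_of_mem (by simp)] at h3
    exact absurd h3 (Finset.card_le_two.trans_lt (by norm_num)).ne
  · rw [Finset.pair_eq_singleton] at h3
    exact absurd h3 (Finset.card_le_two.trans_lt (by norm_num)).ne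

/-- The number of elements of `S` whose link contains the pair `x`, `y`. -/
def linkMult (H : Finset (Finset (Fin n))) (S : Finset (Fin n)) (x y : Fin n) : ℕ :=
  (S.filter fun v => {v, x, y} ∈ H).card

theorem exists_mem_inter_notMem {S P Q T : Finset (Fin n)} (hP : P ⊆ S) (hQ : Q ⊆ S)
    (h : S.card + T.card < P.card + Q.card) : ∃ i ∈ P ∩ Q, i ∉ T := by
  by_contra! hsub
  have h1 := Finset.card_le_card (show P ∩ Q ⊆ T from hsub)
  have h2 := Finset.card_le_card (Finset.union_subset hP hQ)
  have h3 := Finset.card_union_add_card_inter P Q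
  omega

theorem not_fanoFree_of_linkMult (hH : Is3Graph H) {S : Finset (Fin n)} (hS : S.card = 5)
    (hK : ∀ t ⊆ S, t.card = 3 → t ∈ H) {a b c d : Fin n}
    (h₁ : 6 ≤ linkMult H S a b + linkMult H S c d)
    (h₂ : 7 ≤ linkMult H S a c + linkMult H S b d)
    (h₃ : 8 ≤ linkMult H S a d + linkMult H S b c) : ¬ FanoFree H := by
  obtain ⟨i, hi, -⟩ := exists_mem_inter_notMem (T := ∅) (Finset.filter_subset _ S)
    (Finset.filter_subset _ S) (by rw [hS]; exact h₁)
  obtain ⟨j, hj, hji⟩ := exists_mem_inter_notMem (T := {i}) (Finset.filter_subset _ S)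
    (Finset.filter_subset _ S) (by rw [hS]; exact h₂)
  obtain ⟨k, hk, hkij⟩ := exists_mem_inter_notMem (T := {i, j}) (Finset.filter_subset _ S)
    (Finset.filter_subset _ S) (by
      rw [hS]; exact lt_of_lt_of_le (Nat.add_lt_add_left (Nat.lt_succ_of_le Finset.card_le_two) 5) h₃)
  simp only [Finset.mem_inter, Finset.mem_filter, Finset.mem_singleton, Finset.mem_insert,
    not_or] at hi hj hk hji hkij
  have hijk : {k, j, i} ∈ H := hK _ (by simp [Finset.insert_subset_iff, hi.1.1, hj.1.1, hk.1.1]) (by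
    rw [Finset.card_eq_three]; exact ⟨k, j, i, hkij.2, hkij.1, hji, rfl⟩)
  refine not_fanoFree_of_mem hH (p₀ := i) (p₁ := a) (p₂ := b) (p₃ := c) (p₄ := k) (p₅ := j)
    (p₆ := d) hi.1.2 ?_ hijk ?_ ?_ ?_ ?_
  · convert hk.2.2 using 1; grind
  · convert hi.2.2 using 1; grind
  · convert hk.1.2 using 1; grind
  · convert hj.2.2 using 1; grind
  · convert hj.1.2 using 1; grind

/-- The common neighbourhood of a pair of vertices of a 3-graph. -/
def pairNbhd (H : Finset (Finset (Fin n))) (x y : Fin n) : Finset (Fin n) :=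
  Finset.univ.filter fun u => {x, y, u} ∈ H

theorem codeg3_pair (hH : Is3Graph H) (x y : Fin n) :
    codeg3 H {x, y} = (pairNbhd H x y).card := by
  unfold codeg3 pairNbhd
  congr 1
  ext u
  have e : insert u ({x, y} : Finset (Fin n)) = {x, y, u} := by grind
  simp only [Finset.mem_filter, Finset.mem_univ, true_and, e, and_iff_right_iff_imp]
  intro h
  have := pairwise_ne_of_mem hH h
  grind

/-- Indicator of the link of `v`. -/
def linkInd (H : Finset (Finset (Fin n))) (v x y : Fin n) : ℝ :=
  if {v, x, y} ∈ H then 1 else 0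

theorem linkInd_eq_zero_or_one (H : Finset (Finset (Fin n))) (v x y : Fin n) :
    linkInd H v x y = 0 ∨ linkInd H v x y = 1 := by
  unfold linkInd; split_ifs <;> simp

theorem linkInd_eq_one_iff {v x y : Fin n} : linkInd H v x y = 1 ↔ {v, x, y} ∈ H := by
  unfold linkInd; split_ifs <;> simp_all

theorem linkInd_comm (H : Finset (Finset (Fin n))) (v x y : Fin n) :
    linkInd H v x y = linkInd H v y x := by
  unfold linkInd; rw [Finset.pair_comm]

theorem sum_linkInd (hH : Is3Graph H) (v x : Fin n) :
    ∑ y, linkInd H v x y = codeg3 H {v, x} := by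
  rw [codeg3_pair hH]
  simp [linkInd, pairNbhd]

theorem two_mul_sum_powersetCard_two (g : Finset (Fin n) → ℝ) :
    2 * ∑ e ∈ Finset.powersetCard 2 Finset.univ, g e =
      ∑ p ∈ (Finset.univ : Finset (Fin n)).offDiag, g {p.1, p.2} := by
  have hmaps : ∀ p ∈ (Finset.univ : Finset (Fin n)).offDiag,
      ({p.1, p.2} : Finset (Fin n)) ∈ Finset.powersetCard 2 Finset.univ := by
    intro p hp
    simp [Finset.mem_powersetCard, Finset.card_pair (Finset.mem_offDiag.1 hp).2.2]
  rw [← Finset.sum_fiberwise_of_maps_to hmaps, Finset.mul_sum]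
  refine Finset.sum_congr rfl fun e he => ?_
  obtain ⟨x, y, hxy, rfl⟩ := Finset.card_eq_two.1 (Finset.mem_powersetCard.1 he).2
  have hfib : (Finset.univ : Finset (Fin n)).offDiag.filter
      (fun p => ({p.1, p.2} : Finset (Fin n)) = {x, y}) = {(x, y), (y, x)} := by
    ext ⟨p, q⟩
    simp only [Finset.mem_filter, Finset.mem_offDiag, Finset.mem_univ, true_and,
      Finset.mem_insert, Finset.mem_singleton, Prod.mk.injEq]
    constructor
    · rintro ⟨-, h⟩
      have hp : p ∈ ({x, y} : Finset (Fin n)) := h ▸ by simp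
      have hq : q ∈ ({x, y} : Finset (Fin n)) := h ▸ by simp
      simp only [Finset.mem_insert, Finset.mem_singleton] at hp hq
      grind
    · rintro (⟨rfl, rfl⟩ | ⟨rfl, rfl⟩)
      · exact ⟨hxy, rfl⟩
      · exact ⟨hxy.symm, Finset.pair_comm _ _⟩
  rw [hfib, Finset.sum_pair (by simp [hxy]), Finset.pair_comm y x]
  ring

theorem l2norm_eq_sum (H : Finset (Finset (Fin n))) :
    (l2norm H : ℝ) = ∑ e ∈ Finset.powersetCard 2 Finset.univ, (codeg3 H e : ℝ) ^ 2 := by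
  rw [l2norm, Nat.cast_sum]
  push_cast
  refine Finset.sum_subset (fun e he => ?_) fun e he hns => ?_
  · simp only [shadow3, Finset.mem_filter] at he
    simp [Finset.mem_powersetCard, he.2.1]
  · rw [sq_eq_zero_iff, Nat.cast_eq_zero, codeg3, Finset.card_eq_zero,
      Finset.filter_eq_empty_iff]
    rintro v - ⟨-, hv⟩
    refine hns (Finset.mem_filter.2 ⟨Finset.mem_univ _, (Finset.mem_powersetCard.1 he).2, _, hv, ?_⟩)
    exact Finset.subset_insert _ _

theorem sq_codeg3_sub_sq_le (H : Finset (Finset (Fin n))) (v : Fin n) (e : Finset (Fin n)) :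
    (codeg3 H e : ℝ) ^ 2 - (codeg3 (delVert H v) e : ℝ) ^ 2 ≤
      if v ∈ e then (codeg3 H e : ℝ) ^ 2
      else 2 * ((if insert v e ∈ H then 1 else 0) * codeg3 H e) := by
  split_ifs with hv hH
  · exact sub_le_self _ (sq_nonneg _)
  · have hle : codeg3 H e ≤ codeg3 (delVert H v) e + 1 := by
      refine le_trans (Finset.card_le_card fun u hu => ?_) (Finset.card_insert_le v _)
      simp only [Finset.mem_filter, Finset.mem_univ, true_and, Finset.mem_insert, delVert] at hu ⊢
      grind
    have : (codeg3 H e : ℝ) ≤ codeg3 (delVert H v) e + 1 := by exact_mod_cast hle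
    have h0 : (0 : ℝ) ≤ codeg3 (delVert H v) e := Nat.cast_nonneg _
    have h1 : (0 : ℝ) ≤ codeg3 H e := Nat.cast_nonneg _
    rcases le_total (codeg3 (delVert H v) e : ℝ) (codeg3 H e) with h | h <;> nlinarith
  · have hle : codeg3 H e ≤ codeg3 (delVert H v) e := by
      refine Finset.card_le_card fun u hu => ?_
      simp only [Finset.mem_filter, Finset.mem_univ, true_and, Finset.mem_insert, delVert] at hu ⊢
      grind
    have : (codeg3 H e : ℝ) ≤ codeg3 (delVert H v) e := by exact_mod_cast hle
    have h1 : (0 : ℝ) ≤ codeg3 H e := Nat.cast_nonneg _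
    nlinarith

theorem d2deg_le (hH : Is3Graph H) (v : Fin n) :
    d2deg H v ≤ ∑ x, (∑ y, linkInd H v x y) ^ 2
      + ∑ x, ∑ y, linkInd H v x y * codeg3 H {x, y} := by
  have h1 : d2deg H v ≤ ∑ e ∈ Finset.powersetCard 2 Finset.univ,
      if v ∈ e then (codeg3 H e : ℝ) ^ 2
      else 2 * ((if insert v e ∈ H then 1 else 0) * codeg3 H e) := by
    rw [d2deg, l2norm_eq_sum, l2norm_eq_sum, ← Finset.sum_sub_distrib]
    exact Finset.sum_le_sum fun e _ => sq_codeg3_sub_sq_le H v e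
  have h2 := two_mul_sum_powersetCard_two fun e : Finset (Fin n) =>
    if v ∈ e then (codeg3 H e : ℝ) ^ 2
    else 2 * ((if insert v e ∈ H then 1 else 0) * codeg3 H e)
  have h3 : ∀ x y : Fin n, (if v ∈ ({x, y} : Finset (Fin n)) then (codeg3 H {x, y} : ℝ) ^ 2
      else 2 * ((if insert v {x, y} ∈ H then 1 else 0) * codeg3 H {x, y})) ≤
      ((if v = x then (codeg3 H {v, y} : ℝ) ^ 2 else 0)
        + (if v = y then (codeg3 H {v, x} : ℝ) ^ 2 else 0))
        + 2 * (linkInd H v x y * codeg3 H {x, y}) := by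
    intro x y
    have hl : 0 ≤ linkInd H v x y * codeg3 H {x, y} :=
      mul_nonneg (by rcases linkInd_eq_zero_or_one H v x y with h | h <;> simp [h])
        (Nat.cast_nonneg _)
    by_cases hx : v = x
    · subst hx
      have : 0 ≤ (if v = y then (codeg3 H {v, v} : ℝ) ^ 2 else 0) := by positivity
      simp only [Finset.mem_insert_self, if_true]
      linarith
    by_cases hy : v = y
    · subst hy
      rw [if_pos (by simp), if_neg hx, if_pos rfl, Finset.pair_comm x v] at *
      linarith
    rw [if_neg (by simp [hx, hy]), if_neg hx, if_neg hy, linkInd]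
    simp
  have h4 : ∑ p ∈ (Finset.univ : Finset (Fin n)).offDiag,
      (if v ∈ ({p.1, p.2} : Finset (Fin n)) then (codeg3 H {p.1, p.2} : ℝ) ^ 2
      else 2 * ((if insert v {p.1, p.2} ∈ H then 1 else 0) * codeg3 H {p.1, p.2})) ≤
      ∑ x, ∑ y, (((if v = x then (codeg3 H {v, y} : ℝ) ^ 2 else 0)
        + (if v = y then (codeg3 H {v, x} : ℝ) ^ 2 else 0))
        + 2 * (linkInd H v x y * codeg3 H {x, y})) := by
    rw [← Fintype.sum_prod_type']
    refine le_trans (Finset.sum_le_univ_sum_of_nonneg fun p => ?_)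
      (Finset.sum_le_sum fun p _ => h3 p.1 p.2)
    split_ifs <;> positivity
  have h5 : ∑ x, ∑ y, (((if v = x then (codeg3 H {v, y} : ℝ) ^ 2 else 0)
        + (if v = y then (codeg3 H {v, x} : ℝ) ^ 2 else 0))
        + 2 * (linkInd H v x y * codeg3 H {x, y})) =
      2 * (∑ x, (∑ y, linkInd H v x y) ^ 2 + ∑ x, ∑ y, linkInd H v x y * codeg3 H {x, y}) := by
    simp only [sum_linkInd hH, Finset.sum_add_distrib, ← Finset.mul_sum, Finset.sum_ite_eq,
      Finset.mem_univ, if_true]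
    rw [Finset.sum_comm]
    simp only [Finset.sum_ite_eq, Finset.mem_univ, if_true]
    ring
  linarith

theorem two_mul_card_mul_card_sub_le {V : Type*} [Fintype V] [DecidableEq V] (a : V → V → ℝ)
    (h1 : ∀ x y, a x y ≤ 1) (hs : ∀ x y, a x y = a y x) (P Q : Finset V)
    (hPQ : ∀ p ∈ P, ∀ q ∈ Q, a p q = 0) :
    2 * (P.card * Q.card : ℝ) - ((P ∩ Q).card : ℝ) ^ 2 ≤ ∑ x, ∑ y, (1 - a x y) := by
  have hc : ∀ Z : Finset V, (Z.card : ℝ) = ∑ x, if x ∈ Z then 1 else 0 := fun Z => by simp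
  have hpt : ∀ x y, (if x ∈ P then (1 : ℝ) else 0) * (if y ∈ Q then 1 else 0)
      + (if x ∈ Q then (1 : ℝ) else 0) * (if y ∈ P then 1 else 0)
      - (if x ∈ P ∩ Q then (1 : ℝ) else 0) * (if y ∈ P ∩ Q then 1 else 0) ≤ 1 - a x y := by
    intro x y
    have hxy := h1 x y
    have e1 : x ∈ P → y ∈ Q → a x y = 0 := fun hx hy => hPQ x hx y hy
    have e2 : x ∈ Q → y ∈ P → a x y = 0 := fun hx hy => hs x y ▸ hPQ y hy x hx
    by_cases xP : x ∈ P <;> by_cases xQ : x ∈ Q <;> by_cases yP : y ∈ P <;> by_cases yQ : y ∈ Q <;>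
      simp [*] at e1 e2 ⊢
  calc _ = ∑ x, ∑ y, ((if x ∈ P then (1 : ℝ) else 0) * (if y ∈ Q then 1 else 0)
      + (if x ∈ Q then (1 : ℝ) else 0) * (if y ∈ P then 1 else 0)
      - (if x ∈ P ∩ Q then (1 : ℝ) else 0) * (if y ∈ P ∩ Q then 1 else 0)) := by
        simp only [Finset.sum_add_distrib, Finset.sum_sub_distrib, ← Finset.sum_mul_sum, ← hc]
        ring
    _ ≤ _ := Finset.sum_le_sum fun x _ => Finset.sum_le_sum fun y _ => hpt x y

theorem mul_sub_sq_lower_bound {p q r m : ℝ} (hm : 0 ≤ m) (hp : p ≤ m) (hq : q ≤ m)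
    (hr : 0 ≤ r) (hrp : r ≤ p) (hrq : r ≤ q) (hpq : 49 / 40 * m ≤ p + q) :
    3751 / 10000 * m ^ 2 ≤ 2 * (p * q) - r ^ 2 := by
  wlog h : p ≤ q generalizing p q
  · rw [mul_comm p q]
    exact this hq hp hrq hrp (by linarith) (le_of_not_ge h)
  have h1 : r ^ 2 ≤ p ^ 2 := by gcongr
  by_cases hc : p ≤ 49 / 80 * m
  · have h2 : p * (49 / 40 * m - p) ≤ p * q := by
      gcongr
      · linarith
      · linarith
    nlinarith [mul_nonneg (sub_nonneg.2 hc) (show 0 ≤ p - 9 / 40 * m by linarith)]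
  · have h2 : p * p ≤ p * q := by
      gcongr
      linarith
    nlinarith

theorem linkInd_eq_zero_of_fanoFree (hH : Is3Graph H) (hfree : FanoFree H) {v x y z u p q : Fin n}
    (hxy : {v, x, y} ∈ H) (hzu : {v, z, u} ∈ H)
    (hp : p ∈ pairNbhd H x z ∩ pairNbhd H y u) (hq : q ∈ pairNbhd H x u ∩ pairNbhd H y z) :
    linkInd H v p q = 0 := by
  refine (linkInd_eq_zero_or_one H v p q).resolve_right fun hpq => ?_
  rw [linkInd_eq_one_iff] at hpq
  simp only [pairNbhd, Finset.mem_inter, Finset.mem_filter, Finset.mem_univ, true_and] at hp hq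
  refine not_fanoFree_of_mem hH (p₀ := v) (p₁ := x) (p₂ := y) (p₃ := z) (p₄ := q) (p₅ := p)
    (p₆ := u) hxy hq.2 ?_ ?_ hq.1 hp.2 hp.1 hfree
  · convert hpq using 1; grind
  · convert hzu using 1; grind

theorem card_add_card_le_inter_add (P Q : Finset (Fin n)) :
    (P.card : ℝ) + Q.card ≤ (P ∩ Q).card + n := by
  have h1 := Finset.card_union_add_card_inter P Q
  have h2 := Finset.card_le_univ (P ∪ Q)
  rw [Fintype.card_fin] at h2
  exact_mod_cast (by omega : P.card + Q.card ≤ (P ∩ Q).card + n)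

theorem le_sum_codegree_deficit (hH : Is3Graph H) (hfree : FanoFree H) {v : Fin n}
    (hB : ∑ x, ∑ y, (1 - linkInd H v x y) < 3751 / 10000 * (n : ℝ) ^ 2) (x y z u : Fin n)
    (hxy : linkInd H v x y = 1) (hzu : linkInd H v z u = 1) :
    31 / 40 * (n : ℝ) ≤ (n - codeg3 H {x, z}) + (n - codeg3 H {y, z})
      + ((n - codeg3 H {x, u}) + (n - codeg3 H {y, u})) := by
  rw [linkInd_eq_one_iff] at hxy hzu
  by_contra! hlt
  simp only [codeg3_pair hH] at hlt
  set P := pairNbhd H x z ∩ pairNbhd H y u with hP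
  set Q := pairNbhd H x u ∩ pairNbhd H y z with hQ
  have hcount := two_mul_card_mul_card_sub_le (linkInd H v)
    (fun x y => by rcases linkInd_eq_zero_or_one H v x y with h | h <;> simp [h])
    (linkInd_comm H v) P Q
    fun p hp q hq => linkInd_eq_zero_of_fanoFree hH hfree hxy hzu hp hq
  have hle : ∀ Z : Finset (Fin n), (Z.card : ℝ) ≤ n := fun Z => by
    exact_mod_cast (Finset.card_le_univ Z).trans_eq (Fintype.card_fin n)
  have h1 := card_add_card_le_inter_add (pairNbhd H x z) (pairNbhd H y u)
  have h2 := card_add_card_le_inter_add (pairNbhd H x u) (pairNbhd H y z)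
  have := mul_sub_sq_lower_bound (Nat.cast_nonneg n) (hle P) (hle Q)
    (Nat.cast_nonneg (P ∩ Q).card)
    (by exact_mod_cast Finset.card_le_card Finset.inter_subset_left)
    (by exact_mod_cast Finset.card_le_card Finset.inter_subset_right)
    (by rw [← hP] at h1; rw [← hQ] at h2; linarith)
  linarith

theorem link_density_gt (hH : Is3Graph H) (hfree : FanoFree H) (hn : 0 < n) (v : Fin n)
    (hv : (5 / 4 - 1 / 1000000) * (n : ℝ) ^ 3 ≤ d2deg H v) :
    70005 / 100000 * (n : ℝ) ^ 2 < ∑ x, ∑ y, linkInd H v x y := by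
  by_contra! hA
  set a := linkInd H v with ha
  set h : Fin n → Fin n → ℝ := fun x y => codeg3 H {x, y} with hh
  set A := ∑ x, ∑ y, a x y with hAdef
  have hn' : (0 : ℝ) < n := by exact_mod_cast hn
  have a01 : ∀ x y, a x y = 0 ∨ a x y = 1 := linkInd_eq_zero_or_one H v
  have a0 : ∀ x y, 0 ≤ a x y := fun x y => by rcases a01 x y with h | h <;> simp [h]
  have a1 : ∀ x y, a x y ≤ 1 := fun x y => by rcases a01 x y with h | h <;> simp [h]
  have hs : ∀ x y, a x y = a y x := linkInd_comm H v
  have hm : ∀ x y, h x y ≤ n := fun x y => by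
    have : codeg3 H {x, y} ≤ n := (Finset.card_le_univ _).trans_eq (Fintype.card_fin n)
    exact Nat.cast_le.2 this
  have hdeg := hv.trans (d2deg_le hH v)
  set Ψ := ∑ x, (∑ y, a x y) ^ 2 with hΨ
  set D := ∑ x, ∑ y, a x y * (n - h x y) with hD
  have hAh : ∑ x, ∑ y, a x y * codeg3 H {x, y} = n * A - D := by
    simp only [hD, hAdef, mul_sub, Finset.sum_sub_distrib, Finset.mul_sum, hh]
    simp only [mul_comm (n : ℝ)]
    ring
  rw [hAh] at hdeg
  have hD0 : 0 ≤ D := Finset.sum_nonneg fun x _ => Finset.sum_nonneg fun y _ =>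
    mul_nonneg (a0 x y) (sub_nonneg.2 (hm x y))
  have hΨA : Ψ ≤ n * A := by
    rw [hΨ, hAdef, Finset.mul_sum]
    refine Finset.sum_le_sum fun x _ => ?_
    rw [sq]
    refine mul_le_mul_of_nonneg_right ?_ (Finset.sum_nonneg fun y _ => a0 x y)
    exact (Finset.sum_le_sum fun y _ => a1 x y).trans_eq (by simp)
  have hAlow : (5 / 8 - 1 / 2000000) * (n : ℝ) ^ 2 ≤ A := by
    have : (5 / 8 - 1 / 2000000) * (n : ℝ) ^ 2 * n ≤ A * n := by nlinarith
    exact le_of_mul_le_mul_right this hn'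
  have hB : ∑ x, ∑ y, (1 - a x y) = (n : ℝ) ^ 2 - A := by
    simp only [Finset.sum_sub_distrib, hAdef]
    simp [sq]
  have hBlt : ∑ x, ∑ y, (1 - a x y) < 3751 / 10000 * (n : ℝ) ^ 2 := by
    rw [hB]; nlinarith [pow_pos hn' 2]
  have hB0 : 0 ≤ ∑ x, ∑ y, (1 - a x y) := Finset.sum_nonneg fun x _ => Finset.sum_nonneg fun y _ =>
    sub_nonneg.2 (a1 x y)
  set g := √(∑ x, ∑ y, (1 - a x y)) with hg
  have hg2 : g ^ 2 = ∑ x, ∑ y, (1 - a x y) := Real.sq_sqrt hB0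
  have hclosed := sum_cherry_closed_le (fun x y => 1 - a x y) (fun x y => sub_nonneg.2 (a1 x y))
    (fun x y => sub_le_self _ (a0 x y)) (Real.sqrt_nonneg _) hg2.symm
  rw [triangle_identity a hs, Fintype.card_fin] at hclosed
  have htri := triangle_sq_le a h a01 hs hm (by positivity : 0 ≤ 31 / 40 * (n : ℝ))
    fun x y z u hxy _ _ _ _ hzu => le_sum_codegree_deficit hH hfree hBlt x y z u hxy hzu
  rw [← hg2] at htri
  set t := ∑ x, ∑ y, a x y * ∑ z, a x z * a y z with ht
  exact scaled_density_contradiction hn' (Real.sqrt_nonneg _) (hg2.trans hB) hA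
    (by nlinarith [pow_pos hn' 2]) hD0 hclosed hdeg htri

theorem linkMult_comm (H : Finset (Finset (Fin n))) (S : Finset (Fin n)) (x y : Fin n) :
    linkMult H S x y = linkMult H S y x := by
  unfold linkMult; simp only [Finset.pair_comm x y]

theorem linkMult_self (hH : Is3Graph H) (S : Finset (Fin n)) (x : Fin n) :
    linkMult H S x x = 0 := by
  rw [linkMult, Finset.card_eq_zero, Finset.filter_eq_empty_iff]
  exact fun v _ h => (pairwise_ne_of_mem hH h).2.2 rfl

theorem linkMult_le (H : Finset (Finset (Fin n))) (S : Finset (Fin n)) (x y : Fin n) :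
    linkMult H S x y ≤ S.card :=
  Finset.card_filter_le _ _

theorem sum_linkInd_eq_sum_linkMult (H : Finset (Finset (Fin n))) (S : Finset (Fin n)) :
    ∑ v ∈ S, ∑ x, ∑ y, linkInd H v x y = ((∑ x, ∑ y, linkMult H S x y : ℕ) : ℝ) := by
  push_cast
  rw [Finset.sum_comm]
  refine Finset.sum_congr rfl fun x _ => ?_
  rw [Finset.sum_comm]
  refine Finset.sum_congr rfl fun y _ => ?_
  simp [linkInd, linkMult]

theorem sum_linkMult_le (hH : Is3Graph H) (hfree : FanoFree H) {S : Finset (Fin n)}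
    (hS : S.card = 5) (hK : ∀ t ⊆ S, t.card = 3 → t ∈ H) :
    2 * ∑ x, ∑ y, linkMult H S x y ≤ 7 * n ^ 2 + 112 * n := by
  have h5 : ∀ x y, linkMult H S x y ≤ 5 := fun x y => (linkMult_le H S x y).trans_eq hS
  have hmain := weight_sum_le h5 (linkMult_comm H S) (linkMult_self hH S) (U := Finset.univ \ S)
    fun a _ b _ c _ d _ _ _ _ _ _ _ h₁ h₂ h₃ =>
      not_fanoFree_of_linkMult hH hS hK h₁ h₂ h₃ hfree
  have hcard : (Finset.univ \ S).card ≤ n := (Finset.card_le_univ _).trans_eq (Fintype.card_fin n)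
  have hsplit : ∀ F : Fin n → ℕ, ∑ x, F x = ∑ x ∈ Finset.univ \ S, F x + ∑ x ∈ S, F x := fun F =>
    (Finset.sum_sdiff (Finset.subset_univ S)).symm
  have hrow : ∀ x, ∑ y, linkMult H S x y ≤ ∑ y ∈ Finset.univ \ S, linkMult H S x y + 25 := by
    intro x
    rw [hsplit]
    gcongr
    exact (Finset.sum_le_card_nsmul _ _ 5 fun y _ => h5 x y).trans_eq (by simp [hS])
  have hfull : ∀ x, ∑ y, linkMult H S x y ≤ n * 5 := fun x =>
    (Finset.sum_le_card_nsmul _ _ 5 fun y _ => h5 x y).trans_eq (by simp)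
  have hU : ∑ x ∈ Finset.univ \ S, ∑ y, linkMult H S x y ≤
      ∑ x ∈ Finset.univ \ S, ∑ y ∈ Finset.univ \ S, linkMult H S x y + n * 25 := by
    calc _ ≤ ∑ x ∈ Finset.univ \ S, (∑ y ∈ Finset.univ \ S, linkMult H S x y + 25) :=
          Finset.sum_le_sum fun x _ => hrow x
      _ ≤ _ := by
        rw [Finset.sum_add_distrib, Finset.sum_const, smul_eq_mul]
        gcongr
  have hSrow : ∑ x ∈ S, ∑ y, linkMult H S x y ≤ 5 * (n * 5) :=
    (Finset.sum_le_card_nsmul _ _ _ fun x _ => hfull x).trans_eq (by simp [hS])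
  rw [hsplit]
  have : 7 * (Finset.univ \ S).card ^ 2 + 12 * (Finset.univ \ S).card ≤ 7 * n ^ 2 + 12 * n := by
    gcongr
  linarith

end Fano

/-- There exist ε > 0 and N such that for every n ≥ N: if a 3-graph H
on n vertices contains a 5-set S inducing a copy of K₅³ with `d_{2,H}(v) ≥ (5/4 − ε)·n³`
for every v ∈ S, then H contains a copy of the Fano plane. -/
theorem K53_high_l2deg_gives_fano :
    ∃ (ε : ℝ) (N : ℕ), 0 < ε ∧
      ∀ n : ℕ, N ≤ n →
        ∀ (H : Finset (Finset (Fin n))) (S : Finset (Fin n)),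
          Is3Graph H → S.card = 5 → (∀ t ⊆ S, t.card = 3 → t ∈ H) →
          (∀ v ∈ S, ((5 : ℝ) / 4 - ε) * (n : ℝ) ^ 3 ≤ d2deg H v) →
          ¬ FanoFree H := by
  refine ⟨1 / 1000000, 1000000, by norm_num, fun n hn H S hH hS hK hdeg hfree => ?_⟩
  have hupper : (2 : ℝ) * ((∑ x, ∑ y, linkMult H S x y : ℕ) : ℝ) ≤ 7 * n ^ 2 + 112 * n := by
    exact_mod_cast sum_linkMult_le hH hfree hS hK
  rw [← sum_linkInd_eq_sum_linkMult] at hupper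
  have hlower := Finset.card_nsmul_le_sum S (fun v => ∑ x, ∑ y, linkInd H v x y) _ fun v hv =>
    (link_density_gt hH hfree (by omega) v (hdeg v hv)).le
  rw [hS, nsmul_eq_mul] at hlower
  have hn' : (1000000 : ℝ) ≤ n := by exact_mod_cast hn
  push_cast at hlower
  nlinarith
end

section
/- Let n ≥ 3 be an integer and let H be a bipartite 3-graph on n vertices. Then ‖H‖₂ ≤ ‖𝔹ₙ‖₂, and equality holds if and only if H is isomorphic to 𝔹ₙ. -/
/-- A 3-graph is bipartite if its vertex set can be partitioned into `A` and `Aᶜ` such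
that every edge intersects both parts. -/
def Bipartite3 {n : ℕ} (H : Finset (Finset (Fin n))) : Prop :=
  ∃ A : Finset (Fin n), ∀ e ∈ H, (e ∩ A).Nonempty ∧ (e \ A).Nonempty
/-- The balanced complete bipartite 3-graph `𝔹ₙ` on `Fin n`: the parts are the first
`⌈n/2⌉` vertices and the remaining `⌊n/2⌋` vertices, and the edges are all 3-sets
meeting both parts. -/
def balBipartite (n : ℕ) : Finset (Finset (Fin n)) :=
  (Finset.univ.powersetCard 3).filter fun e =>
    (∃ v ∈ e, (v : ℕ) < (n + 1) / 2) ∧ ∃ v ∈ e, (n + 1) / 2 ≤ (v : ℕ)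

/-- Two 3-graphs on `Fin n` are isomorphic. -/
def Iso3 {n : ℕ} (H G : Finset (Finset (Fin n))) : Prop :=
  ∃ f : Fin n ≃ Fin n, ∀ e : Finset (Fin n), e ∈ H ↔ e.image f ∈ G

/-- The complete bipartite 3-graph with parts `A` and `Aᶜ`. -/
def completeBip {n : ℕ} (A : Finset (Fin n)) : Finset (Finset (Fin n)) :=
  (Finset.univ.powersetCard 3).filter fun e => (e ∩ A).Nonempty ∧ (e \ A).Nonempty

/-- Pairs outside the shadow have codegree zero, so the ℓ2-norm is a sum over all pairs. -/
theorem l2norm_eq_sum_pairs {n : ℕ} (H : Finset (Finset (Fin n))) :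
    l2norm H = ∑ e ∈ Finset.univ.powersetCard 2, codeg3 H e ^ 2 := by
  unfold l2norm
  apply Finset.sum_subset
  · intro e he
    simp only [shadow3, Finset.mem_filter] at he
    simp [Finset.mem_powersetCard, he.2.1]
  · intro e he he'
    have h0 : codeg3 H e = 0 := by
      rw [codeg3, Finset.card_eq_zero, Finset.filter_eq_empty_iff]
      rintro v - ⟨-, hv⟩
      apply he'
      simp only [shadow3, Finset.mem_filter, Finset.mem_univ, true_and]
      exact ⟨(Finset.mem_powersetCard.1 he).2, _, hv, Finset.subset_insert v e⟩
    simp [h0]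

theorem codeg3_mono {n : ℕ} {H G : Finset (Finset (Fin n))} (h : H ⊆ G) (e : Finset (Fin n)) :
    codeg3 H e ≤ codeg3 G e :=
  Finset.card_le_card (Finset.monotone_filter_right _ fun _ _ hv => ⟨hv.1, h hv.2⟩)

theorem l2norm_mono {n : ℕ} {H G : Finset (Finset (Fin n))} (h : H ⊆ G) :
    l2norm H ≤ l2norm G := by
  rw [l2norm_eq_sum_pairs, l2norm_eq_sum_pairs]
  exact Finset.sum_le_sum fun e _ => Nat.pow_le_pow_left (codeg3_mono h e) 2

theorem l2norm_lt_of_ssubset {n : ℕ} {H G : Finset (Finset (Fin n))} (hG : Is3Graph G)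
    (h : H ⊂ G) : l2norm H < l2norm G := by
  have hsub := h.1
  obtain ⟨E, hE, hE'⟩ := Finset.exists_of_ssubset h
  have hcard := hG E hE
  obtain ⟨v, hv⟩ : E.Nonempty := Finset.card_pos.1 (by omega)
  rw [l2norm_eq_sum_pairs, l2norm_eq_sum_pairs]
  refine Finset.sum_lt_sum (fun e _ => Nat.pow_le_pow_left (codeg3_mono hsub e) 2)
    ⟨E.erase v, ?_, ?_⟩
  · simp [Finset.mem_powersetCard, Finset.card_erase_of_mem hv, hcard]
  · refine Nat.pow_lt_pow_left (Finset.card_lt_card ?_) two_ne_zero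
    rw [Finset.ssubset_iff_of_subset
      (Finset.monotone_filter_right _ fun _ _ hv => ⟨hv.1, hsub hv.2⟩)]
    exact ⟨v, by simp [Finset.insert_erase hv, hE], by simp [Finset.insert_erase hv, hE']⟩

theorem codeg3_completeBip_of_subset {n : ℕ} {A e : Finset (Fin n)} (he : e.card = 2)
    (hA : e ⊆ A) : codeg3 (completeBip A) e = Aᶜ.card := by
  unfold codeg3
  congr 1
  ext v
  obtain ⟨w, hw⟩ : e.Nonempty := Finset.card_pos.1 (by omega)
  simp only [completeBip, Finset.mem_filter, Finset.mem_univ, true_and, Finset.mem_powersetCard,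
    Finset.subset_univ, Finset.mem_compl]
  constructor
  · rintro ⟨-, -, -, x, hx⟩ hv
    grind
  · intro hv
    have hve : v ∉ e := fun h => hv (hA h)
    exact ⟨hve, by rw [Finset.card_insert_of_notMem hve, he], ⟨w, by grind⟩, ⟨v, by grind⟩⟩

theorem codeg3_completeBip_of_crossing {n : ℕ} {A e : Finset (Fin n)} (he : e.card = 2)
    (h₁ : ¬ e ⊆ A) (h₂ : ¬ e ⊆ Aᶜ) : codeg3 (completeBip A) e = n - 2 := by
  have h : codeg3 (completeBip A) e = eᶜ.card := by
    unfold codeg3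
    congr 1
    ext v
    simp only [completeBip, Finset.mem_filter, Finset.mem_univ, true_and,
      Finset.mem_powersetCard, Finset.subset_univ, Finset.mem_compl]
    refine ⟨fun h => h.1, fun hve => ?_⟩
    obtain ⟨x, hx, hxA⟩ := Finset.not_subset.1 h₁
    obtain ⟨y, hy, hyA⟩ := Finset.not_subset.1 h₂
    rw [Finset.mem_compl, not_not] at hyA
    exact ⟨hve, by rw [Finset.card_insert_of_notMem hve, he], ⟨y, by grind⟩, ⟨x, by grind⟩⟩
  rw [h, Finset.card_compl, he, Fintype.card_fin]

theorem completeBip_compl {n : ℕ} (A : Finset (Fin n)) : completeBip Aᶜ = completeBip A := by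
  ext e
  simp only [completeBip, Finset.mem_filter]
  rw [show e ∩ Aᶜ = e \ A by ext; simp, show e \ Aᶜ = e ∩ A by ext; simp]
  tauto

theorem l2norm_completeBip {n : ℕ} (A : Finset (Fin n)) :
    l2norm (completeBip A) = A.card.choose 2 * Aᶜ.card ^ 2 + Aᶜ.card.choose 2 * A.card ^ 2 +
      (n.choose 2 - A.card.choose 2 - Aᶜ.card.choose 2) * (n - 2) ^ 2 := by
  set P := (Finset.univ : Finset (Fin n)).powersetCard 2
  have hA : P.filter (· ⊆ A) = A.powersetCard 2 := by
    ext e; simp [P, Finset.mem_powersetCard]; tauto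
  have hB : (P.filter (¬ · ⊆ A)).filter (· ⊆ Aᶜ) = Aᶜ.powersetCard 2 := by
    ext e
    simp only [P, Finset.mem_filter, Finset.mem_powersetCard, Finset.subset_univ, true_and]
    constructor
    · tauto
    · rintro ⟨h, he⟩
      refine ⟨⟨he, fun h' => ?_⟩, h⟩
      obtain ⟨w, hw⟩ : e.Nonempty := Finset.card_pos.1 (by omega)
      exact Finset.mem_compl.1 (h hw) (h' hw)
  have c₁ := Finset.card_filter_add_card_filter_not (s := P) (· ⊆ A)
  have c₂ := Finset.card_filter_add_card_filter_not (s := P.filter (¬ · ⊆ A)) (· ⊆ Aᶜ)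
  rw [hA, Finset.card_powersetCard] at c₁
  rw [hB, Finset.card_powersetCard] at c₂
  have hP : P.card = n.choose 2 := by simp [P]
  rw [l2norm_eq_sum_pairs, ← Finset.sum_filter_add_sum_filter_not P (· ⊆ A),
    ← Finset.sum_filter_add_sum_filter_not (P.filter (¬ · ⊆ A)) (· ⊆ Aᶜ), hA, hB, ← add_assoc]
  congr 1
  · congr 1
    · rw [Finset.sum_congr rfl (g := fun _ => Aᶜ.card ^ 2), Finset.sum_const,
        Finset.card_powersetCard, smul_eq_mul]
      intro e he
      rw [Finset.mem_powersetCard] at he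
      rw [codeg3_completeBip_of_subset he.2 he.1]
    · rw [Finset.sum_congr rfl (g := fun _ => A.card ^ 2), Finset.sum_const,
        Finset.card_powersetCard, smul_eq_mul]
      intro e he
      rw [Finset.mem_powersetCard] at he
      rw [← completeBip_compl, codeg3_completeBip_of_subset he.2 he.1, compl_compl]
  · rw [Finset.sum_congr rfl (g := fun _ => (n - 2) ^ 2), Finset.sum_const, smul_eq_mul]
    · congr 1
      omega
    · intro e he
      simp only [P, Finset.mem_filter, Finset.mem_powersetCard] at he
      rw [codeg3_completeBip_of_crossing he.1.1.2 he.1.2 he.2]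

theorem choose_two_cast (m : ℕ) : 2 * ((m.choose 2 : ℕ) : ℤ) = m * (m - 1) := by
  induction m with
  | zero => simp
  | succ k ih =>
    rw [Nat.choose_succ_succ' k 1, Nat.choose_one_right]
    push_cast
    linarith

theorem two_mul_l2norm_completeBip {n : ℕ} (hn : 3 ≤ n) (A : Finset (Fin n)) :
    2 * (l2norm (completeBip A) : ℤ) = (A.card * (n - A.card)) *
      (2 * (A.card * (n - A.card)) - n + 2 * (n - 2) ^ 2) := by
  have hc : A.card + Aᶜ.card = n := by simp [Finset.card_add_card_compl]
  rw [l2norm_completeBip]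
  generalize A.card = a at *
  generalize Aᶜ.card = b at *
  have ha := choose_two_cast a
  have hb := choose_two_cast b
  have hN := choose_two_cast n
  have hle : a.choose 2 + b.choose 2 ≤ n.choose 2 := by
    zify
    have : (n : ℤ) = a + b := by exact_mod_cast hc.symm
    rw [this] at hN
    nlinarith [mul_nonneg (Int.natCast_nonneg a) (Int.natCast_nonneg b)]
  rw [Nat.sub_sub]
  push_cast [Nat.cast_sub hle, Nat.cast_sub (show 2 ≤ n by omega)]
  have hn' : (n : ℤ) = a + b := by exact_mod_cast hc.symm
  rw [hn'] at hN ⊢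
  linear_combination (b : ℤ) ^ 2 * ha + (a : ℤ) ^ 2 * hb +
    ((a : ℤ) + b - 2) ^ 2 * (hN - ha - hb)

/-- The first part of the balanced bipartition. -/
def firstHalf (n : ℕ) : Finset (Fin n) := Finset.univ.filter fun v => (v : ℕ) < (n + 1) / 2

theorem card_firstHalf (n : ℕ) : (firstHalf n).card = (n + 1) / 2 := by
  rw [firstHalf, Fin.card_filter_val_lt]
  omega

theorem balBipartite_eq_completeBip (n : ℕ) : balBipartite n = completeBip (firstHalf n) := by
  ext e
  simp [balBipartite, completeBip, firstHalf, Finset.Nonempty]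

theorem is3Graph_completeBip {n : ℕ} (A : Finset (Fin n)) : Is3Graph (completeBip A) :=
  fun _ he => (Finset.mem_powersetCard.1 (Finset.mem_filter.1 he).1).2

theorem l2norm_completeBip_le {n : ℕ} (hn : 3 ≤ n) (A : Finset (Fin n)) :
    l2norm (completeBip A) ≤ l2norm (balBipartite n) ∧
    (l2norm (completeBip A) = l2norm (balBipartite n) →
      A.card = (firstHalf n).card ∨ Aᶜ.card = (firstHalf n).card) := by
  have hc : A.card + Aᶜ.card = n := by simp [Finset.card_add_card_compl]
  have h₁ := two_mul_l2norm_completeBip hn A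
  have h₀ := two_mul_l2norm_completeBip hn (firstHalf n)
  rw [← balBipartite_eq_completeBip] at h₀
  rw [card_firstHalf] at h₀ ⊢
  generalize A.card = a at *
  generalize Aᶜ.card = b at *
  obtain ⟨m, hm⟩ : ∃ m, (n + 1) / 2 = m := ⟨_, rfl⟩
  rw [hm] at h₀ ⊢
  have hdiff : (m : ℤ) * (n - m) - a * (n - a) = (a - m) * (a - (n - m)) := by ring
  have hnn : 0 ≤ ((a : ℤ) - m) * (a - (n - m)) := by
    rcases le_or_gt m a with h | h
    · exact mul_nonneg (by omega) (by omega)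
    · exact mul_nonneg_of_nonpos_of_nonpos (by omega) (by omega)
  have hp : (0 : ℤ) ≤ a * (n - a) := mul_nonneg (by omega) (by omega)
  have hq : (2 : ℤ) ≤ m * (n - m) := by
    have : (2 : ℤ) ≤ m := by omega
    have : (1 : ℤ) ≤ n - m := by omega
    nlinarith
  have hn' : (3 : ℤ) ≤ n := by exact_mod_cast hn
  have hk : (-1 : ℤ) ≤ -n + 2 * (n - 2) ^ 2 := by nlinarith
  generalize (m : ℤ) * (n - m) = q at *
  generalize (a : ℤ) * (n - a) = p at *
  have hfac : 2 * ((l2norm (balBipartite n) : ℤ) - l2norm (completeBip A)) =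
      (q - p) * (2 * (q + p) - n + 2 * (n - 2) ^ 2) := by
    linear_combination h₀ - h₁
  have hpos : 0 < 2 * (q + p) - n + 2 * ((n : ℤ) - 2) ^ 2 := by linarith
  constructor
  · zify
    have := mul_nonneg (hdiff ▸ hnn : 0 ≤ q - p) hpos.le
    linarith
  · intro h
    rw [h, sub_self, mul_zero, eq_comm, mul_eq_zero, hdiff, mul_eq_zero] at hfac
    omega

theorem l2norm_eq_of_iso {n : ℕ} {H G : Finset (Finset (Fin n))} (h : Iso3 H G) :
    l2norm H = l2norm G := by
  obtain ⟨f, hf⟩ := h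
  rw [l2norm_eq_sum_pairs, l2norm_eq_sum_pairs]
  refine Finset.sum_equiv f.finsetCongr ?_ ?_
  · intro e
    simp [Finset.mem_powersetCard]
  · intro e _
    congr 1
    unfold codeg3
    refine Finset.card_equiv f fun v => ?_
    simp only [Finset.mem_filter, Finset.mem_univ, true_and, hf, Finset.image_insert,
      Equiv.finsetCongr_apply, Finset.map_eq_image, Equiv.coe_toEmbedding,
      Finset.mem_image, EmbeddingLike.apply_eq_iff_eq, exists_eq_right]

theorem iso_completeBip {n : ℕ} {A B : Finset (Fin n)} (h : A.card = B.card) :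
    Iso3 (completeBip A) (completeBip B) := by
  obtain ⟨g⟩ : Nonempty ({x // x ∈ A} ≃ {x // x ∈ B}) :=
    Fintype.card_eq.1 (by simpa using h)
  have hg : ∀ x, g.extendSubtype x ∈ B ↔ x ∈ A := fun x =>
    ⟨fun hx => by_contra fun hA => g.extendSubtype_not_mem x hA hx, g.extendSubtype_mem x⟩
  refine ⟨g.extendSubtype, fun e => ?_⟩
  simp [completeBip, Finset.mem_powersetCard, Finset.Nonempty,
    Finset.card_image_of_injective _ g.extendSubtype.injective, hg]

/-- For n ≥ 3, every bipartite 3-graph H on n vertices satisfies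
`‖H‖₂ ≤ ‖𝔹ₙ‖₂`, with equality if and only if H is isomorphic to 𝔹ₙ. -/
theorem bipartite_l2_max (n : ℕ) (hn : 3 ≤ n) (H : Finset (Finset (Fin n)))
    (hH : Is3Graph H) (hbip : Bipartite3 H) :
    l2norm H ≤ l2norm (balBipartite n) ∧
    (l2norm H = l2norm (balBipartite n) ↔ Iso3 H (balBipartite n)) := by
  obtain ⟨A, hA⟩ := hbip
  have hsub : H ⊆ completeBip A := fun e he => by
    simp [completeBip, Finset.mem_powersetCard, hH e he, hA e he]
  obtain ⟨hle, heq⟩ := l2norm_completeBip_le hn A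
  refine ⟨(l2norm_mono hsub).trans hle, fun h => ?_, l2norm_eq_of_iso⟩
  obtain rfl : H = completeBip A := by
    by_contra hne
    have := l2norm_lt_of_ssubset (is3Graph_completeBip A) (hsub.ssubset_of_ne hne)
    omega
  rw [balBipartite_eq_completeBip]
  rcases heq h with hc | hc
  · exact iso_completeBip hc
  · rw [← completeBip_compl A]
    exact iso_completeBip hc
end

section
/- Let 𝒢 = (G₁,…,G₅) be a 𝕂₄-free 5-multigraph on the four-element vertex set {w,x,y,z}, and assume μ(wx)+μ(yz) ≥ μ(wy)+μ(xz) ≥ μ(wz)+μ(xy). Then: (i) if μ(wx)+μ(yz) ≥ 8 and μ(wy)+μ(xz) ≥ 7, then C(wz) ∩ C(xy) = ∅, and in particular μ(wz)+μ(xy) ≤ 5; (ii) |𝒢| ≤ 25; (iii) if |𝒢| ≥ 22, then some pair of vertices has multiplicity 5. -/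
/-- A 5-multigraph `(G₁,…,G₅)` on `Fin n`: each `G i` is the edge set of a simple graph,
so every edge is a 2-element subset. -/
def IsMulti5 {n : ℕ} (G : Fin 5 → Finset (Finset (Fin n))) : Prop :=
  ∀ i, ∀ e ∈ G i, e.card = 2

/-- The size of a 5-multigraph: `|𝒢| = ∑ᵢ |Gᵢ|`. -/
def msize {n : ℕ} (G : Fin 5 → Finset (Finset (Fin n))) : ℕ := ∑ i, (G i).card

/-- The degree of a vertex in a 5-multigraph: `d_𝒢(v) = ∑ᵢ d_{Gᵢ}(v)`. -/
def mdeg {n : ℕ} (G : Fin 5 → Finset (Finset (Fin n))) (v : Fin n) : ℕ :=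
  ∑ i, ((G i).filter fun e => v ∈ e).card

/-- The multiplicity of a pair `{u,v}`: the number of indices `i` with `uv ∈ Gᵢ`. -/
def mult5 {n : ℕ} (G : Fin 5 → Finset (Finset (Fin n))) (u v : Fin n) : ℕ :=
  (Finset.univ.filter fun i : Fin 5 => ({u, v} : Finset (Fin n)) ∈ G i).card

/-- A 5-multigraph contains `𝕂₄` if there are three distinct indices `i, j, k` and four
distinct vertices `a, b, c, d` with `{ab, cd} ⊆ Gᵢ`, `{ac, bd} ⊆ Gⱼ`, `{ad, bc} ⊆ G_k`. -/
def ContainsK4 {n : ℕ} (G : Fin 5 → Finset (Finset (Fin n))) : Prop :=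
  ∃ i j k : Fin 5, ∃ a b c d : Fin n,
    i ≠ j ∧ i ≠ k ∧ j ≠ k ∧
    a ≠ b ∧ a ≠ c ∧ a ≠ d ∧ b ≠ c ∧ b ≠ d ∧ c ≠ d ∧
    ({a, b} : Finset (Fin n)) ∈ G i ∧ ({c, d} : Finset (Fin n)) ∈ G i ∧
    ({a, c} : Finset (Fin n)) ∈ G j ∧ ({b, d} : Finset (Fin n)) ∈ G j ∧
    ({a, d} : Finset (Fin n)) ∈ G k ∧ ({b, c} : Finset (Fin n)) ∈ G k

/-- The color set of a pair `{u,v}`: the set of indices `i ∈ [5]` with `uv ∈ Gᵢ`. -/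
def colorSet {n : ℕ} (G : Fin 5 → Finset (Finset (Fin n))) (u v : Fin n) : Finset (Fin 5) :=
  Finset.univ.filter fun i => ({u, v} : Finset (Fin n)) ∈ G i

/-- The two-element subsets of a four-element vertex set, listed without repetition. -/
lemma powersetCard_two_univ_val (w x y z : Fin 4) (hwx : w ≠ x) (hwy : w ≠ y) (hwz : w ≠ z)
    (hxy : x ≠ y) (hxz : x ≠ z) (hyz : y ≠ z) :
    ((Finset.univ : Finset (Fin 4)).powersetCard 2).val =
      {{w, x}, {y, z}, {w, y}, {x, z}, {w, z}, {x, y}} := by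
  decide +revert

/-- The size of a 5-multigraph on four vertices is the sum of the six multiplicities. -/
lemma msize_eq_sum_mult5 {G : Fin 5 → Finset (Finset (Fin 4))} (hG : IsMulti5 G)
    {w x y z : Fin 4} (hwx : w ≠ x) (hwy : w ≠ y) (hwz : w ≠ z)
    (hxy : x ≠ y) (hxz : x ≠ z) (hyz : y ≠ z) :
    msize G = (mult5 G w x + mult5 G y z) + (mult5 G w y + mult5 G x z) +
      (mult5 G w z + mult5 G x y) := by
  have card_eq (i : Fin 5) : (G i).card =
      ∑ e ∈ (Finset.univ : Finset (Fin 4)).powersetCard 2, if e ∈ G i then 1 else 0 := by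
    rw [← Finset.card_filter]
    congr 1
    ext e
    simpa using hG i e
  simp only [msize, card_eq, Finset.sum,
    powersetCard_two_univ_val w x y z hwx hwy hwz hxy hxz hyz]
  simp only [mult5, Finset.card_filter, ← Finset.sum_add_distrib]
  exact Finset.sum_congr rfl fun i _ => by
    simp only [Multiset.insert_eq_cons, Multiset.map_cons, Multiset.map_singleton,
      Multiset.sum_cons, Multiset.sum_singleton]
    ring

lemma mult5_eq_card_colorSet {n : ℕ} (G : Fin 5 → Finset (Finset (Fin n))) (u v : Fin n) :
    mult5 G u v = (colorSet G u v).card := rfl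

lemma mult5_le_five {n : ℕ} (G : Fin 5 → Finset (Finset (Fin n))) (u v : Fin n) :
    mult5 G u v ≤ 5 := by
  simpa [mult5_eq_card_colorSet] using Finset.card_le_univ (colorSet G u v)

/-- Two color sets share at least as many colors as their sizes force. -/
lemma mult5_add_le_card_inter {n : ℕ} (G : Fin 5 → Finset (Finset (Fin n)))
    (a b c d : Fin n) :
    mult5 G a b + mult5 G c d ≤ (colorSet G a b ∩ colorSet G c d).card + 5 := by
  have h := Finset.card_union_add_card_inter (colorSet G a b) (colorSet G c d)
  have h_union : (colorSet G a b ∪ colorSet G c d).card ≤ 5 := by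
    simpa using Finset.card_le_univ (colorSet G a b ∪ colorSet G c d)
  simp only [mult5_eq_card_colorSet]
  omega

/-- If two of the perfect matchings on `w, x, y, z` have many edges, then the third one is not
contained in any single color class of a `𝕂₄`-free 5-multigraph. -/
lemma colorSet_inter_eq_empty {n : ℕ} {G : Fin 5 → Finset (Finset (Fin n))}
    (hK4 : ¬ ContainsK4 G) {w x y z : Fin n}
    (hwx : w ≠ x) (hwy : w ≠ y) (hwz : w ≠ z) (hxy : x ≠ y) (hxz : x ≠ z) (hyz : y ≠ z)
    (h8 : 8 ≤ mult5 G w x + mult5 G y z) (h7 : 7 ≤ mult5 G w y + mult5 G x z) :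
    colorSet G w z ∩ colorSet G x y = ∅ := by
  by_contra hne
  obtain ⟨k, hk⟩ := Finset.nonempty_iff_ne_empty.mpr hne
  have h₁ := mult5_add_le_card_inter G w x y z
  have h₂ := mult5_add_le_card_inter G w y x z
  obtain ⟨j, hj, hjk⟩ :=
    Finset.exists_mem_ne (s := colorSet G w y ∩ colorSet G x z) (by omega) k
  obtain ⟨i, hi, hijk⟩ := Finset.exists_mem_notMem_of_card_lt_card
    (s := {j, k}) (t := colorSet G w x ∩ colorSet G y z)
    (lt_of_le_of_lt Finset.card_le_two (by omega))
  simp only [Finset.mem_insert, Finset.mem_singleton, not_or] at hijk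
  simp only [colorSet, Finset.mem_inter, Finset.mem_filter, Finset.mem_univ, true_and]
    at hi hj hk
  exact hK4 ⟨i, j, k, w, x, y, z, hijk.1, hijk.2, hjk, hwx, hwy, hwz, hxy, hxz, hyz,
    hi.1, hi.2, hj.1, hj.2, hk.1, hk.2⟩

/-- Basic properties of 𝕂₄-free 5-multigraphs on the four-element
vertex set `{w, x, y, z}`, assuming `μ(wx)+μ(yz) ≥ μ(wy)+μ(xz) ≥ μ(wz)+μ(xy)`:
(i) if `μ(wx)+μ(yz) ≥ 8` and `μ(wy)+μ(xz) ≥ 7` then `C(wz) ∩ C(xy) = ∅` and in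
particular `μ(wz)+μ(xy) ≤ 5`; (ii) `|𝒢| ≤ 25`; (iii) if `|𝒢| ≥ 22` then some pair of
vertices has multiplicity 5. -/
theorem four_vertex_multigraph (G : Fin 5 → Finset (Finset (Fin 4)))
    (hG : IsMulti5 G) (hK4 : ¬ ContainsK4 G)
    (w x y z : Fin 4)
    (hwx : w ≠ x) (hwy : w ≠ y) (hwz : w ≠ z) (hxy : x ≠ y) (hxz : x ≠ z) (hyz : y ≠ z)
    (hord1 : mult5 G w y + mult5 G x z ≤ mult5 G w x + mult5 G y z)
    (hord2 : mult5 G w z + mult5 G x y ≤ mult5 G w y + mult5 G x z) :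
    (8 ≤ mult5 G w x + mult5 G y z → 7 ≤ mult5 G w y + mult5 G x z →
      colorSet G w z ∩ colorSet G x y = ∅ ∧ mult5 G w z + mult5 G x y ≤ 5) ∧
    msize G ≤ 25 ∧
    (22 ≤ msize G → ∃ u v : Fin 4, u ≠ v ∧ mult5 G u v = 5) := by
  have main (h8 : 8 ≤ mult5 G w x + mult5 G y z) (h7 : 7 ≤ mult5 G w y + mult5 G x z) :
      colorSet G w z ∩ colorSet G x y = ∅ ∧ mult5 G w z + mult5 G x y ≤ 5 := by
    have h_empty := colorSet_inter_eq_empty hK4 hwx hwy hwz hxy hxz hyz h8 h7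
    have h := mult5_add_le_card_inter G w z x y
    rw [h_empty, Finset.card_empty, zero_add] at h
    exact ⟨h_empty, h⟩
  have h_size := msize_eq_sum_mult5 hG hwx hwy hwz hxy hxz hyz
  have h_wx := mult5_le_five G w x
  have h_yz := mult5_le_five G y z
  have h_wy := mult5_le_five G w y
  have h_xz := mult5_le_five G x z
  refine ⟨main, ?_, fun h22 => ?_⟩
  · by_contra! h
    have := (main (by omega) (by omega)).2
    omega
  · by_contra! h
    have h_wx' := h w x hwx
    have h_yz' := h y z hyz
    have h_wy' := h w y hwy
    have h_xz' := h x z hxz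
    have := (main (by omega) (by omega)).2
    omega
end

section
/- Let n be a positive integer and let 𝒢 = (G₁,…,G₅) be a 𝕂₄-free 5-multigraph on n vertices with δ(𝒢) ≥ 44n/13. Then there do not exist three distinct vertices x, y, z ∈ V(𝒢) such that μ(xy) ≥ 3, μ(xz) ≥ 3, and μ(yz) ≥ 3. -/
section Weighted

variable {V : Type*}

/-- The numerical consequence of `𝕂₄`-freeness for a multiplicity function with at most five
colours: three opposite pairs of a tetrahedron cannot share at least one, two and three colours. -/
def NumericK4Free (μ : V → V → ℕ) : Prop :=
  ∀ a b c d, 6 ≤ μ a b + μ c d → 7 ≤ μ a c + μ b d → μ a d + μ b c < 8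

/-- Pairwise multiplicities at least three. -/
def HeavyTriangle (μ : V → V → ℕ) (x y z : V) : Prop :=
  3 ≤ μ x y ∧ 3 ≤ μ x z ∧ 3 ≤ μ y z

/-- If no vertex has weighted multiplicity above the average forced by the minimum degree, then
every vertex attains that average. -/
theorem weighted_mult_eq [Fintype V] {μ : V → V → ℕ}
    (hdeg : ∀ v, 44 * Fintype.card V ≤ 13 * ∑ u, μ u v) (x y z w : V) (α β γ δ : ℕ)
    (h : ∀ u, 13 * (α * μ u x + β * μ u y + γ * μ u z + δ * μ u w) ≤ 44 * (α + β + γ + δ))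
    (u : V) :
    13 * (α * μ u x + β * μ u y + γ * μ u z + δ * μ u w) = 44 * (α + β + γ + δ) := by
  have hsum : ∑ u, 13 * (α * μ u x + β * μ u y + γ * μ u z + δ * μ u w) =
      ∑ _u : V, 44 * (α + β + γ + δ) := by
    refine le_antisymm (Finset.sum_le_sum fun u _ => h u) ?_
    simp only [← Finset.mul_sum, Finset.sum_add_distrib, Finset.sum_const, Finset.card_univ,
      smul_eq_mul]
    nlinarith [Nat.mul_le_mul_left α (hdeg x), Nat.mul_le_mul_left β (hdeg y),
      Nat.mul_le_mul_left γ (hdeg z), Nat.mul_le_mul_left δ (hdeg w)]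
  exact (Finset.sum_eq_sum_iff_of_le fun u _ => h u).1 hsum u (Finset.mem_univ u)

/-- Constraints on the multiplicities `a, b, c` from a vertex to the vertices `x, y, z` of a
triangle with multiplicities `p = μ y z`, `q = μ x z`, `r = μ x y`, when every heavy triangle has
total multiplicity at most `M`. -/
structure RowConstraints (M p q r a b c : ℕ) : Prop where
  ha : a ≤ 5
  hb : b ≤ 5
  hc : c ≤ 5
  hab : 3 ≤ a → 3 ≤ b → 3 ≤ r → a + b + r ≤ M
  hac : 3 ≤ a → 3 ≤ c → 3 ≤ q → a + c + q ≤ M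
  hbc : 3 ≤ b → 3 ≤ c → 3 ≤ p → b + c + p ≤ M
  abc : 6 ≤ a + p → 7 ≤ b + q → c + r < 8
  acb : 6 ≤ a + p → 7 ≤ c + r → b + q < 8
  bac : 6 ≤ b + q → 7 ≤ a + p → c + r < 8
  bca : 6 ≤ b + q → 7 ≤ c + r → a + p < 8
  cab : 6 ≤ c + r → 7 ≤ a + p → b + q < 8
  cba : 6 ≤ c + r → 7 ≤ b + q → a + p < 8

theorem rowConstraints {μ : V → V → ℕ} (hsymm : ∀ u v, μ u v = μ v u) (hle : ∀ u v, μ u v ≤ 5)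
    (hfree : NumericK4Free μ) {M : ℕ}
    (hmax : ∀ a b c, HeavyTriangle μ a b c → μ a b + μ a c + μ b c ≤ M) (x y z u : V) :
    RowConstraints M (μ y z) (μ x z) (μ x y) (μ u x) (μ u y) (μ u z) where
  ha := hle _ _
  hb := hle _ _
  hc := hle _ _
  hab h₁ h₂ h₃ := hmax u x y ⟨h₁, h₂, h₃⟩
  hac h₁ h₂ h₃ := hmax u x z ⟨h₁, h₂, h₃⟩
  hbc h₁ h₂ h₃ := hmax u y z ⟨h₁, h₂, h₃⟩
  abc := hfree u x y z
  acb := by simpa only [hsymm z y] using hfree u x z y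
  bac := by simpa only [hsymm y x] using hfree u y x z
  bca := by simpa only [hsymm y x, hsymm z x] using hfree u y z x
  cab := by simpa only [hsymm z y, hsymm z x] using hfree u z x y
  cba := by simpa only [hsymm z y, hsymm z x, hsymm y x] using hfree u z y x

theorem RowConstraints.sum_le_ten_or {a b c : ℕ} (h : RowConstraints 11 5 3 3 a b c) :
    a + b + c ≤ 10 ∨ a = 5 ∧ b = 3 ∧ c = 3 := by
  obtain ⟨_, _, _, _, _, _, _, _, _, _, _, _⟩ := h
  omega

theorem RowConstraints.exists_weights {p q r : ℕ} (hr : 3 ≤ r) (hrq : r ≤ q) (hqp : q ≤ p)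
    (hp : p ≤ 5) (hne : ¬(p = 5 ∧ q = 3 ∧ r = 3)) :
    ∃ α β γ : ℕ, 13 * (α * q + β * p) < 44 * (α + β + γ) ∧
      ∀ a b c, RowConstraints (p + q + r) p q r a b c →
        13 * (α * a + β * b + γ * c) ≤ 44 * (α + β + γ) := by
  have hcases : (p = 5 ∧ q = 5 ∧ r = 3) ∨ (p = 5 ∧ q = 5 ∧ r = 4) ∨ (p = 5 ∧ q = 4 ∧ r = 3) ∨
      (p = 5 ∧ q = 4 ∧ r = 4) ∨ (p = 5 ∧ q = 5 ∧ r = 5) ∨ (p = 4 ∧ q = 3 ∧ r = 3) ∨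
      (p = 4 ∧ q = 4 ∧ r = 3) ∨ (p = 4 ∧ q = 4 ∧ r = 4) ∨ (p = 3 ∧ q = 3 ∧ r = 3) := by omega
  obtain h | h | h | h | h := hcases
  · exact ⟨3, 3, 7, by omega, fun a b c ⟨_, _, _, _, _, _, _, _, _, _, _, _⟩ => by omega⟩
  · exact ⟨2, 2, 3, by omega, fun a b c ⟨_, _, _, _, _, _, _, _, _, _, _, _⟩ => by omega⟩
  · exact ⟨1, 2, 3, by omega, fun a b c ⟨_, _, _, _, _, _, _, _, _, _, _, _⟩ => by omega⟩
  · exact ⟨1, 2, 2, by omega, fun a b c ⟨_, _, _, _, _, _, _, _, _, _, _, _⟩ => by omega⟩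
  · refine ⟨1, 1, 1, by omega, fun a b c ⟨_, _, _, _, _, _, _, _, _, _, _, _⟩ => ?_⟩
    obtain h | h | h | h | h := h <;> omega

theorem not_maximal_heavyTriangle [Fintype V] {μ : V → V → ℕ}
    (hself : ∀ v, μ v v = 0) (hsymm : ∀ u v, μ u v = μ v u) (hle : ∀ u v, μ u v ≤ 5)
    (hfree : NumericK4Free μ) (hdeg : ∀ v, 44 * Fintype.card V ≤ 13 * ∑ u, μ u v)
    {x y z : V} (hxy : 3 ≤ μ x y) (hxz : μ x y ≤ μ x z) (hyz : μ x z ≤ μ y z)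
    (hmax : ∀ a b c, HeavyTriangle μ a b c →
      μ a b + μ a c + μ b c ≤ μ y z + μ x z + μ x y) : False := by
  by_cases h533 : μ y z = 5 ∧ μ x z = 3 ∧ μ x y = 3
  · obtain ⟨hp, hq, hr⟩ := h533
    have row : ∀ a b c u, μ b c = 5 → μ a c = 3 → μ a b = 3 →
        μ u a + μ u b + μ u c ≤ 10 ∨ μ u a = 5 ∧ μ u b = 3 ∧ μ u c = 3 := by
      intro a b c u h₁ h₂ h₃
      have := rowConstraints hsymm hle hfree hmax a b c u
      rw [h₁, h₂, h₃, hp, hq, hr] at this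
      exact this.sum_le_ten_or
    obtain ⟨v, hv⟩ : ∃ v, 10 < μ v x + μ v y + μ v z := by
      by_contra! h
      have := weighted_mult_eq hdeg x y z z 1 1 1 0 (fun u => by have := h u; omega) z
      have := h z
      omega
    obtain ⟨hvx, hvy, hvz⟩ := (row x y z v hp hq hr).resolve_left (by omega)
    have hxv := hsymm v x
    have hyv := hsymm v y
    have hzv := hsymm v z
    have hyx := hsymm x y
    have hzx := hsymm x z
    have := weighted_mult_eq hdeg x y z v 1 1 1 1 (fun u => by
      have h₁ := row x y z u hp hq hr
      have h₂ := row v y z u hp hvz hvy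
      have h₃ := row y x v u (by omega) (by omega) (by omega)
      have h₄ := row z x v u (by omega) (by omega) (by omega)
      omega) z
    omega
  · obtain ⟨α, β, γ, hlt, hrow⟩ :=
      RowConstraints.exists_weights hxy hxz hyz (hle y z) h533
    have heq := weighted_mult_eq hdeg x y z z α β γ 0
      (fun u => by simpa using hrow _ _ _ (rowConstraints hsymm hle hfree hmax x y z u)) z
    rw [hself z, hsymm z x, hsymm z y] at heq
    omega

theorem not_heavyTriangle [Fintype V] {μ : V → V → ℕ}
    (hself : ∀ v, μ v v = 0) (hsymm : ∀ u v, μ u v = μ v u) (hle : ∀ u v, μ u v ≤ 5)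
    (hfree : NumericK4Free μ) (hdeg : ∀ v, 44 * Fintype.card V ≤ 13 * ∑ u, μ u v)
    (x y z : V) : ¬HeavyTriangle μ x y z := by
  classical
  intro hxyz
  obtain ⟨⟨a, b, c⟩, habc, hmax⟩ := Set.exists_max_image
    {t : V × V × V | HeavyTriangle μ t.1 t.2.1 t.2.2}
    (fun t => μ t.1 t.2.1 + μ t.1 t.2.2 + μ t.2.1 t.2.2) (Set.toFinite _) ⟨(x, y, z), hxyz⟩
  obtain ⟨hab, hac, hbc⟩ : HeavyTriangle μ a b c := habc
  have not_sorted : ∀ x y z : V, ¬(3 ≤ μ x y ∧ μ x y ≤ μ x z ∧ μ x z ≤ μ y z ∧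
      μ a b + μ a c + μ b c = μ y z + μ x z + μ x y) :=
    fun x y z ⟨h₁, h₂, h₃, h⟩ => not_maximal_heavyTriangle hself hsymm hle hfree hdeg h₁ h₂ h₃
      fun u v w huvw => h ▸ hmax (u, v, w) huvw
  have hba := hsymm b a
  have hca := hsymm c a
  have hcb := hsymm c b
  have h₁ := not_sorted a b c
  have h₂ := not_sorted a c b
  have h₃ := not_sorted b a c
  have h₄ := not_sorted b c a
  have h₅ := not_sorted c a b
  have h₆ := not_sorted c b a
  omega

end Weighted

section Multigraph

variable {n : ℕ} {G : Fin 5 → Finset (Finset (Fin n))}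

theorem mult5_comm (u v : Fin n) : mult5 G u v = mult5 G v u := by
  simp only [mult5, Finset.pair_comm]

theorem mult5_le (u v : Fin n) : mult5 G u v ≤ 5 := by
  simpa [mult5] using Finset.card_filter_le Finset.univ fun i : Fin 5 => {u, v} ∈ G i

theorem mult5_self (hG : IsMulti5 G) (v : Fin n) : mult5 G v v = 0 := by
  simp only [mult5, Finset.card_eq_zero, Finset.filter_eq_empty_iff]
  intro i _ h
  simpa using hG i _ h

theorem mdeg_eq_sum_mult5 (hG : IsMulti5 G) (v : Fin n) : mdeg G v = ∑ u, mult5 G u v := by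
  simp only [mdeg, mult5, Finset.card_filter _ Finset.univ]
  rw [Finset.sum_comm]
  refine Finset.sum_congr rfl fun i _ => ?_
  rw [← Finset.card_filter]
  symm
  refine Finset.card_bij (fun u _ => {u, v}) (by simp) ?_ ?_
  · intro a ha b hb hab
    have hav : a ≠ v := by
      rintro rfl
      simpa using hG i _ (Finset.mem_filter.1 ha).2
    have : a ∈ ({b, v} : Finset (Fin n)) := hab ▸ Finset.mem_insert_self a {v}
    simpa [hav] using this
  · intro e he
    obtain ⟨hei, hve⟩ := Finset.mem_filter.1 he
    obtain ⟨a, b, -, rfl⟩ := Finset.card_eq_two.1 (hG i e hei)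
    obtain rfl | rfl : v = a ∨ v = b := by simpa using hve
    · exact ⟨b, by simpa [Finset.pair_comm] using hei, Finset.pair_comm _ _⟩
    · exact ⟨a, by simpa using hei, rfl⟩

/-- Opposite pairs share at least `k + 1` colours once their multiplicities sum to `6 + k`, so a
common colour can be chosen outside any `k` prescribed ones. -/
theorem exists_common_colour {a b c d : Fin n} (s : Finset (Fin 5))
    (h : 6 + s.card ≤ mult5 G a b + mult5 G c d) :
    ∃ i ∉ s, ({a, b} : Finset (Fin n)) ∈ G i ∧ ({c, d} : Finset (Fin n)) ∈ G i := by
  simp only [mult5] at h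
  set S := Finset.univ.filter fun i : Fin 5 => ({a, b} : Finset (Fin n)) ∈ G i with hS
  set T := Finset.univ.filter fun i : Fin 5 => ({c, d} : Finset (Fin n)) ∈ G i with hT
  have hunion : (S ∪ T).card ≤ 5 := by simpa using Finset.card_le_univ (S ∪ T)
  have hinter := Finset.card_union_add_card_inter S T
  obtain ⟨i, hi, his⟩ := Finset.exists_mem_notMem_of_card_lt_card (s := s) (t := S ∩ T) (by omega)
  exact ⟨i, his, by simpa [hS, hT] using hi⟩

theorem numericK4Free_mult5 (hG : IsMulti5 G) (hK4 : ¬ContainsK4 G) :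
    NumericK4Free (mult5 G) := by
  intro a b c d h₁ h₂
  by_contra! h₃
  obtain ⟨i, -, hab, hcd⟩ := exists_common_colour (G := G) ∅ h₁
  obtain ⟨j, hj, hac, hbd⟩ := exists_common_colour (G := G) {i} h₂
  obtain ⟨k, hk, had, hbc⟩ := exists_common_colour (G := G) {i, j}
    ((Nat.add_le_add_left Finset.card_le_two 6).trans h₃)
  simp only [Finset.mem_insert, Finset.mem_singleton, not_or] at hj hk
  have ne : ∀ {l u v}, ({u, v} : Finset (Fin n)) ∈ G l → u ≠ v := by
    rintro l u _ h rfl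
    simpa using hG l _ h
  exact hK4 ⟨i, j, k, a, b, c, d, Ne.symm hj, Ne.symm hk.1, Ne.symm hk.2, ne hab, ne hac, ne had,
    ne hbc, ne hbd, ne hcd, hab, hcd, hac, hbd, had, hbc⟩

end Multigraph

/-- A 𝕂₄-free 5-multigraph on n ≥ 1 vertices with minimum degree at
least 44n/13 contains no three distinct vertices whose three pairs all have
multiplicity at least 3. -/
theorem no_heavy_triangle (n : ℕ) (hn : 0 < n)
    (G : Fin 5 → Finset (Finset (Fin n))) (hG : IsMulti5 G) (hK4 : ¬ ContainsK4 G)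
    (hdeg : ∀ v : Fin n, (44 : ℝ) * n / 13 ≤ (mdeg G v : ℝ)) :
    ¬ ∃ x y z : Fin n, x ≠ y ∧ x ≠ z ∧ y ≠ z ∧
      3 ≤ mult5 G x y ∧ 3 ≤ mult5 G x z ∧ 3 ≤ mult5 G y z := by
  rintro ⟨x, y, z, -, -, -, hxy, hxz, hyz⟩
  refine not_heavyTriangle (mult5_self hG) mult5_comm mult5_le (numericK4Free_mult5 hG hK4) ?_
    x y z ⟨hxy, hxz, hyz⟩
  intro v
  have h := hdeg v
  rw [div_le_iff₀ (by norm_num), mdeg_eq_sum_mult5 hG] at h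
  rw [Fintype.card_fin, mul_comm 13]
  exact_mod_cast h
end
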